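/- arXiv:1709.03825 — 4 statements merged into one kernel-verified Lean document; each statement's English description precedes it below -/
import Mathlib

section
/- Let (T,M) be a Noetherian local ring with M not an associated prime of T, and let P be a minimal prime of T with dim(T/P) = n. Then there exists a saturated chain of prime ideals P ⊊ Q₁ ⊊ ... ⊊ Q_{n-1} ⊊ M such that for each i = 1,...,n-1, Q_i is not an associated prime of T and P is the only minimal prime of T contained in Q_i. -/
open IsLocalRing

/-- A chain of primes indexed by `Fin (n+1)` is saturated if each step is a covering
relation in `Spec`. -/
def IsSaturatedChain {R : Type} [CommRing R] {n : ℕ} (f : Fin (n + 1) → PrimeSpectrum R) : Prop :=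
  ∀ i : Fin n, f i.castSucc ⋖ f i.succ

/-- Between two primes `p < r` which are not adjacent there is a prime covering `p` that avoids
a given finite set of primes. -/
lemma PrimeSpectrum.exists_covBy_lt_notMem {R : Type*} [CommRing R] [IsNoetherianRing R]
    {p q r : PrimeSpectrum R} (hpq : p < q) (hqr : q < r) {S : Set (PrimeSpectrum R)}
    (hS : S.Finite) : ∃ Q : PrimeSpectrum R, p ⋖ Q ∧ Q < r ∧ Q ∉ S := by
  set S' : Set (PrimeSpectrum R) := {s ∈ insert p S | ¬ r ≤ s}
  have hS' : S'.Finite := (hS.insert p).subset (Set.sep_subset _ _)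
  obtain ⟨x, hxr, hx⟩ : ∃ x ∈ r.asIdeal, ∀ s ∈ S', x ∉ s.asIdeal := by
    have h := mt (Ideal.subset_union_prime_finite hS' (f := PrimeSpectrum.asIdeal) p p
      (fun i _ _ _ ↦ i.isPrime) (I := r.asIdeal)).1 (fun ⟨s, hs, hrs⟩ ↦ hs.2 hrs)
    obtain ⟨x, hxr, hx⟩ := Set.not_subset.1 h
    exact ⟨x, hxr, fun s hs hxs ↦ hx (Set.mem_biUnion hs hxs)⟩
  have hle : Ideal.span (insert x (p.asIdeal : Set R)) ≤ r.asIdeal :=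
    Ideal.span_le.2 (Set.insert_subset hxr (hpq.trans hqr).le)
  obtain ⟨Q, hQ, hQr⟩ := Ideal.exists_minimalPrimes_le hle
  have hxQ : x ∈ Q := hQ.1.2 (Ideal.subset_span (Set.mem_insert _ _))
  have hpQ : p.asIdeal ≤ Q := fun y hy ↦ hQ.1.2 (Ideal.subset_span (Set.mem_insert_of_mem _ hy))
  have hxp : x ∉ p.asIdeal := hx p ⟨Set.mem_insert _ _, (hpq.trans hqr).not_ge⟩
  have hcov : p ⋖ (⟨Q, hQ.1.1⟩ : PrimeSpectrum R) := by
    refine ⟨lt_of_le_of_ne hpQ fun h ↦ hxp (h ▸ hxQ), fun c hpc hcQ ↦ ?_⟩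
    have hc : c.asIdeal ∈ (Ideal.span (p.asIdeal : Set R)).minimalPrimes :=
      Ideal.mem_minimalPrimes_span_of_mem_minimalPrimes_span_insert hcQ x _ hQ _ hpc.le
        fun y hy ↦ Ideal.le_radical (Ideal.subset_span (Set.mem_insert_of_mem _ hy))
    exact hpc.not_ge (hc.2 ⟨p.isPrime, by simp⟩ hpc.le)
  have hlt : (⟨Q, hQ.1.1⟩ : PrimeSpectrum R) < r :=
    lt_of_le_of_ne hQr fun h ↦ hcov.2 hpq (h ▸ hqr)
  exact ⟨_, hcov, hlt, fun hmem ↦ hx _ ⟨Set.mem_insert_of_mem _ hmem, hlt.not_ge⟩ hxQ⟩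

/-- The primes strictly inside a chain can be replaced by non-associated primes that contain no
minimal primes other than those contained in the bottom of the chain. -/
lemma exists_strictMono_notMem_associatedPrimes {R : Type*} [CommRing R] [IsNoetherianRing R]
    {P : Ideal R} : ∀ {n : ℕ} (q : Fin (n + 1) → PrimeSpectrum R), StrictMono q →
    (∀ P' ∈ minimalPrimes R, P' ≤ (q 0).asIdeal → P' = P) →
    ∃ f : Fin (n + 1) → PrimeSpectrum R, StrictMono f ∧ f 0 = q 0 ∧
      f (Fin.last n) = q (Fin.last n) ∧
      ∀ j : Fin (n + 1), j ≠ 0 → j ≠ Fin.last n →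
        (f j).asIdeal ∉ associatedPrimes R R ∧
        ∀ P' ∈ minimalPrimes R, P' ≤ (f j).asIdeal → P' = P
  | 0, q, hq, _ => ⟨q, hq, rfl, rfl, fun j h0 => (h0 (Subsingleton.elim (α := Fin 1) j 0)).elim⟩
  | 1, q, hq, _ => ⟨q, hq, rfl, rfl, fun j h0 hl => by
      fin_cases j
      · exact (h0 rfl).elim
      · exact (hl rfl).elim⟩
  | n + 2, q, hq, hmin => by
    set S : Set (Ideal R) := associatedPrimes R R ∪
      ⋃ P' ∈ minimalPrimes R, ((q 0).asIdeal ⊔ P').minimalPrimes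
    have hS : S.Finite := (associatedPrimes.finite R R).union
      ((minimalPrimes.finite_of_isNoetherianRing R).biUnion
        fun P' _ ↦ Ideal.finite_minimalPrimes_of_isNoetherianRing R _)
    obtain ⟨Q, hcov, hlt, hQS⟩ := PrimeSpectrum.exists_covBy_lt_notMem
      (hq (Fin.succ_pos (0 : Fin (n + 2))))
      (hq (Fin.succ_lt_succ_iff.2 (Fin.succ_pos (0 : Fin (n + 1)))))
      (hS.preimage (f := PrimeSpectrum.asIdeal)
        (fun _ _ _ _ h ↦ PrimeSpectrum.ext h))
    have hQmin : ∀ P' ∈ minimalPrimes R, P' ≤ Q.asIdeal → P' = P := by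
      intro P' hP' hle
      by_contra hne
      obtain ⟨m, hm, hmQ⟩ := Ideal.exists_minimalPrimes_le (sup_le hcov.lt.le hle)
      have hqm : q 0 < ⟨m, hm.1.1⟩ := by
        refine lt_of_le_of_ne (le_sup_left.trans hm.1.2) fun h ↦ hne (hmin P' hP' ?_)
        rw [h]
        exact le_sup_right.trans hm.1.2
      have hmQ' : (⟨m, hm.1.1⟩ : PrimeSpectrum R) = Q := 
        eq_of_le_of_not_lt hmQ (hcov.2 hqm)
      exact hQS (Or.inr (Set.mem_biUnion hP' (hmQ' ▸ hm)))
    obtain ⟨g, hg, hg0, hgl, hgood⟩ := exists_strictMono_notMem_associatedPrimes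
      (Fin.cons Q (fun i : Fin (n + 1) ↦ q i.succ.succ) : Fin (n + 2) → PrimeSpectrum R)
      (by
        rw [Fin.strictMono_iff_lt_succ]
        intro i
        cases i using Fin.cases with
        | zero => simpa using hlt
        | succ i => simpa [← Fin.succ_castSucc] using hq (by simp [Fin.lt_def]))
      (by simpa using hQmin)
    refine ⟨(Fin.cons (q 0) g : Fin (n + 3) → PrimeSpectrum R), ?_, by simp, ?_, ?_⟩
    · rw [Fin.strictMono_iff_lt_succ]
      intro i
      cases i using Fin.cases with
      | zero => simpa [hg0] using hcov.lt
      | succ i => simpa [← Fin.succ_castSucc] using hg (by simp [Fin.lt_def])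
    · rw [← Fin.succ_last, Fin.cons_succ, hgl, ← Fin.succ_last, Fin.cons_succ]
    · intro j hj0 hjl
      cases j using Fin.cases with
      | zero => exact (hj0 rfl).elim
      | succ j =>
        rw [Fin.cons_succ]
        rcases eq_or_ne j 0 with rfl | hj
        · rw [hg0, Fin.cons_zero]
          exact ⟨fun h ↦ hQS (Or.inl h), hQmin⟩
        · exact hgood j hj fun h ↦ hjl (by rw [h, Fin.succ_last])

/-- A chain whose length is the coheight of its bottom element is saturated. -/
lemma StrictMono.covBy_of_coheight_eq {α : Type*} [Preorder α] {n : ℕ} {f : Fin (n + 1) → α}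
    (hf : StrictMono f) (h : Order.coheight (f 0) = n) (i : Fin n) :
    f i.castSucc ⋖ f i.succ := by
  refine ⟨hf i.castSucc_lt_succ, fun c h₁ h₂ ↦ ?_⟩
  have hlen := Order.length_le_coheight (x := f 0)
    (p := LTSeries.mk (n + 1) _ (Fin.strictMono_insertNth hf i c h₁ h₂)) (by
      change f 0 ≤ Fin.insertNth i.castSucc.succ (α := fun _ ↦ α) c f 0
      rw [Fin.insertNth_apply_below (Fin.succ_pos _)]
      simp)
  rw [h] at hlen
  have : n + 1 ≤ n := by exact_mod_cast hlen
  omega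

/-- The dimension of `R ⧸ P` is the coheight of `P` in the prime spectrum. -/
lemma PrimeSpectrum.coheight_eq_ringKrullDim_quotient {R : Type*} [CommRing R]
    (p : PrimeSpectrum R) : (Order.coheight p : WithBot ℕ∞) = ringKrullDim (R ⧸ p.asIdeal) := by
  rw [ringKrullDim_quotient, Order.coheight_eq_krullDim_Ici]
  rfl

/-- Let `(T,M)` be a Noetherian local ring with `M ∉ Ass T`, and `P ∈ Min T` with
`dim (T/P) = n`.  Then there is a saturated chain of primes from `P` to `M` of length `n`
such that every intermediate prime `Qᵢ` is not an associated prime of `T` and contains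
`P` as its only minimal prime. -/
theorem stmt0 (T : Type) [CommRing T] [IsLocalRing T] [IsNoetherianRing T]
    (hM : maximalIdeal T ∉ associatedPrimes T T)
    (P : Ideal T) (hP : P.IsPrime) (hPmin : P ∈ minimalPrimes T)
    (n : ℕ) (hdim : ringKrullDim (T ⧸ P) = (n : WithBot ℕ∞)) :
    ∃ f : Fin (n + 1) → PrimeSpectrum T,
      IsSaturatedChain f ∧
      f 0 = ⟨P, hP⟩ ∧
      (f (Fin.last n)).asIdeal = maximalIdeal T ∧
      ∀ j : Fin (n + 1), j ≠ 0 → j ≠ Fin.last n →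
        (f j).asIdeal ∉ associatedPrimes T T ∧
        ∀ P' ∈ minimalPrimes T, P' ≤ (f j).asIdeal → P' = P := by
  have hbelow : ∀ P' ∈ minimalPrimes T, P' ≤ P → P' = P :=
    fun P' hP' hle ↦ le_antisymm hle (hPmin.2 hP'.1 hle)
  have hco : Order.coheight (⟨P, hP⟩ : PrimeSpectrum T) = n := by
    have := PrimeSpectrum.coheight_eq_ringKrullDim_quotient (⟨P, hP⟩ : PrimeSpectrum T)
    rw [hdim] at this
    exact_mod_cast this
  obtain ⟨s, hs, rfl⟩ := Order.exists_series_of_le_coheight _ hco.ge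
  have hs0 : s.toFun 0 = ⟨P, hP⟩ := hs
  obtain ⟨f, hf, hf0, hfl, hgood⟩ := exists_strictMono_notMem_associatedPrimes (P := P) s.toFun
    s.strictMono (by rw [hs0]; exact hbelow)
  rw [hs0] at hf0
  refine ⟨f, hf.covBy_of_coheight_eq (by rw [hf0, hco]), hf0, ?_, hgood⟩
  by_contra hne
  have hlt : s.last < closedPoint T := lt_of_le_of_ne (le_maximalIdeal s.last.isPrime.ne_top)
    fun h ↦ hne (by rw [hfl]; exact congrArg PrimeSpectrum.asIdeal h)
  have hlen := Order.length_le_coheight (x := (⟨P, hP⟩ : PrimeSpectrum T))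
    (p := s.snoc _ hlt) (by rw [RelSeries.head_snoc, hs])
  rw [hco] at hlen
  have : s.length + 1 ≤ s.length := by exact_mod_cast hlen
  omega
end

section
/- Let A be a Noetherian local domain with completion T (with maximal ideal M). Let P₀ ⊊ P₁ ⊊ ... ⊊ P_{n-1} ⊊ M be a chain of primes of T with n ≥ 2 and P₀ ∩ A = (0). If the contracted chain satisfies (0) = P₀ ∩ A = P₁ ∩ A ⊊ P₂ ∩ A ⊊ ... ⊊ P_{n-1} ∩ A ⊊ M ∩ A, then the chain (0) ⊊ P₂ ∩ A ⊊ ... ⊊ P_{n-1} ∩ A ⊊ M ∩ A in A is not saturated. -/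
open IsLocalRing

/-- Let `q < p` be primes of a Noetherian `A`-algebra `T` with `p` minimal over `(p ∩ A)T`. If
`q ∩ A < p ∩ A` is a saturated chain of primes of `A`, then `q` is minimal over `(q ∩ A)T`. -/
theorem mem_minimalPrimes_map_comap_of_saturated {A T : Type*} [CommRing A] [CommRing T]
    [IsNoetherianRing T] (φ : A →+* T) {q p : Ideal T} [q.IsPrime] (hqp : q < p)
    (hlt : q.comap φ < p.comap φ)
    (hsat : ∀ Q : Ideal A, Q.IsPrime → q.comap φ < Q → ¬ Q < p.comap φ)
    (hp : p ∈ ((p.comap φ).map φ).minimalPrimes) :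
    q ∈ ((q.comap φ).map φ).minimalPrimes := by
  obtain ⟨x, hxp, hxq⟩ := SetLike.exists_of_lt hlt
  have hins : Ideal.span (insert (φ x) (φ '' (q.comap φ))) ≤ p := by
    rw [Ideal.span_le, Set.insert_subset_iff]
    exact ⟨hxp, Set.image_subset_iff.mpr hlt.le⟩
  refine Ideal.mem_minimalPrimes_span_of_mem_minimalPrimes_span_insert hqp (φ x)
    (s := φ '' (q.comap φ)) ⟨⟨hp.isPrime, hins⟩, fun r ⟨hr, hxr⟩ hrp ↦ ?_⟩ _
    (Set.image_subset_iff.mpr subset_rfl) (fun y hy ↦ Ideal.le_radical (Ideal.subset_span (.inr hy)))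
  rw [Ideal.span_le, Set.insert_subset_iff, Set.image_subset_iff] at hxr
  have hlt' : q.comap φ < r.comap φ :=
    lt_of_le_of_ne hxr.2 fun h ↦ hxq (h ▸ hxr.1)
  have hle : p.comap φ ≤ r.comap φ :=
    not_lt_iff_le_imp_ge.mp (hsat _ (hr.comap φ) hlt') (Ideal.comap_mono hrp)
  exact hp.2 ⟨hr, Ideal.map_le_iff_le_comap.mpr hle⟩ hrp

/-- The maximal ideal of a ring isomorphic over `A` to the completion of a local ring `A` with
finitely generated maximal ideal is extended from `A`. -/
theorem map_maximalIdeal_eq_of_adicCompletion_equiv {A T : Type*} [CommRing A] [IsLocalRing A]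
    [CommRing T] [IsLocalRing T] [Algebra A T] (hfg : (maximalIdeal A).FG)
    (e : AdicCompletion (maximalIdeal A) A ≃+* T)
    (he : ∀ a : A, e (algebraMap A (AdicCompletion (maximalIdeal A) A) a) = algebraMap A T a) :
    (maximalIdeal A).map (algebraMap A T) = maximalIdeal T := by
  have := AdicCompletion.isMaximal_map_of_le _ _ (le_refl (maximalIdeal A)) hfg
  have hmap : (maximalIdeal A).map (algebraMap A T) =
      ((maximalIdeal A).map (algebraMap A (AdicCompletion (maximalIdeal A) A))).map e := by
    rw [show algebraMap A T = (e : AdicCompletion (maximalIdeal A) A →+* T).comp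
        (algebraMap A (AdicCompletion (maximalIdeal A) A)) from
      RingHom.ext fun a ↦ (he a).symm, ← Ideal.map_map]
    rfl
  rw [hmap]
  exact eq_maximalIdeal (Ideal.map_isMaximal_of_equiv e)

/-- Lemma: let `A` be a Noetherian local domain whose completion is `T`, and let
`P₀ ⊊ P₁ ⊊ ⋯ ⊊ P_{n-1} ⊊ M` be a chain of primes of `T` with `n ≥ 2` and `P₀ ∩ A = (0)`.
If the contracted chain satisfies
`(0) = P₀ ∩ A = P₁ ∩ A ⊊ P₂ ∩ A ⊊ ⋯ ⊊ P_{n-1} ∩ A ⊊ M ∩ A`, then the chain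
`(0) ⊊ P₂ ∩ A ⊊ ⋯ ⊊ M ∩ A` (i.e. the contractions of `P₁, …, P_{n-1}, M`) is not
saturated in `A`. -/
theorem stmt2 (A T : Type) [CommRing A] [IsDomain A] [IsLocalRing A] [IsNoetherianRing A]
    [CommRing T] [IsLocalRing T] [IsNoetherianRing T] [Algebra A T]
    -- `T` is the completion of `A`, compatibly with the algebra map
    (hcompl : ∃ e : AdicCompletion (maximalIdeal A) A ≃+* T,
      ∀ a : A, e (algebraMap A (AdicCompletion (maximalIdeal A) A) a) = algebraMap A T a)
    (n : ℕ) (hn : 2 ≤ n)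
    (f : Fin (n + 1) → PrimeSpectrum T) (hchain : StrictMono f)
    (hlast : (f (Fin.last n)).asIdeal = maximalIdeal T)
    (h0 : ((f 0).asIdeal).comap (algebraMap A T) = ⊥)
    (h1 : ((f 1).asIdeal).comap (algebraMap A T) = ⊥)
    (hstrict : StrictMono (fun i : Fin n => ((f i.succ).asIdeal).comap (algebraMap A T))) :
    -- the contracted chain `g i = (f i.succ) ∩ A` is not saturated:
    ∃ (i : Fin n) (hi : (i : ℕ) + 1 < n) (Q : Ideal A), Q.IsPrime ∧
      ((f i.succ).asIdeal).comap (algebraMap A T) < Q ∧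
      Q < ((f (⟨(i : ℕ) + 1, hi⟩ : Fin n).succ).asIdeal).comap (algebraMap A T) := by
  obtain ⟨e, he⟩ := hcompl
  by_contra! hsat
  have hmin : ∀ i : Fin (n + 1), i ≠ 0 →
      (f i).asIdeal ∈ (((f i).asIdeal.comap (algebraMap A T)).map
        (algebraMap A T)).minimalPrimes := by
    intro i
    induction i using Fin.reverseInduction with
    | last =>
      intro _
      have hT := map_maximalIdeal_eq_of_adicCompletion_equiv
        (maximalIdeal A).fg_of_isNoetherianRing e he
      have hle : maximalIdeal A ≤ (maximalIdeal T).comap (algebraMap A T) :=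
        Ideal.map_le_iff_le_comap.mp hT.le
      rw [hlast]
      exact ⟨⟨inferInstance, Ideal.map_comap_le⟩,
        fun r ⟨_, hr⟩ _ ↦ hT.symm.le.trans ((Ideal.map_mono hle).trans hr)⟩
    | cast i ih =>
      intro hi
      obtain ⟨j, hj⟩ := Fin.exists_succ_eq.mpr hi
      have hji : (j : ℕ) + 1 = i := congrArg Fin.val hj
      have hjn : (j : ℕ) + 1 < n := hji ▸ i.isLt
      have hk : (⟨(j : ℕ) + 1, hjn⟩ : Fin n) = i := Fin.ext hji
      have hlt := hstrict (show j < i from Fin.lt_def.mpr (by lia))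
      have hsat' := hsat j hjn
      rw [hk] at hsat'
      simp only [hj] at hlt hsat'
      exact mem_minimalPrimes_map_comap_of_saturated (algebraMap A T)
        (hchain i.castSucc_lt_succ) hlt hsat' (ih i.succ_ne_zero)
  have hone : (1 : Fin (n + 1)) ≠ 0 := by simp [Fin.ext_iff]; lia
  have hlt : f 0 < f 1 := hchain (Fin.pos_iff_ne_zero.mpr hone)
  have h1' := hmin 1 hone
  rw [h1, Ideal.map_bot] at h1'
  exact hlt.not_ge (h1'.2 ⟨(f 0).isPrime, bot_le⟩ hlt.le)
end

section
/- Let A be a Noetherian local domain with completion T having maximal ideal M. Let P₀ ⊊ P₁ ⊊ ... ⊊ P_{n-1} ⊊ M be a chain of prime ideals of T of length n ≥ 2 with P₀ ∩ A = (0). If the chain of contractions (0) = P₀ ∩ A ⊆ P₁ ∩ A ⊆ ... ⊆ P_{n-1} ∩ A ⊆ M ∩ A has length strictly less than n (i.e., some two consecutive contractions are equal), then the chain of distinct contracted primes is not saturated in A. -/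
open IsLocalRing

/-- If a prime `N` is minimal over the extension of its contraction, `P < N` is a prime with
strictly smaller contraction, and no prime lies strictly between the two contractions, then `P` is
minimal over the extension of its contraction. -/
theorem mem_minimalPrimes_map_comap_of_lt {A T : Type*} [CommRing A] [CommRing T]
    [IsNoetherianRing T] (φ : A →+* T) {P N : Ideal T} [P.IsPrime] [N.IsPrime] (hPN : P < N)
    (hlt : P.comap φ < N.comap φ)
    (hsat : ∀ Q : Ideal A, Q.IsPrime → P.comap φ < Q → ¬ Q < N.comap φ)
    (hmin : N ∈ ((N.comap φ).map φ).minimalPrimes) :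
    P ∈ ((P.comap φ).map φ).minimalPrimes := by
  obtain ⟨x, hxN, hxP⟩ := SetLike.exists_of_lt hlt
  have hsub : φ '' (P.comap φ) ⊆ P := Set.image_subset_iff.mpr fun _ h => h
  refine Ideal.mem_minimalPrimes_span_of_mem_minimalPrimes_span_insert hPN (φ x)
    (φ '' (P.comap φ)) ⟨⟨‹_›, ?_⟩, fun Q ⟨hQ, hspan⟩ hQN => ?_⟩ _ hsub
    ((Set.subset_insert _ _).trans (Ideal.subset_span.trans Ideal.le_radical))
  · exact Ideal.span_le.mpr (Set.insert_subset hxN (hsub.trans hPN.le))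
  · rw [Ideal.span_le, Set.insert_subset_iff] at hspan
    have hPQ : P.comap φ < Q.comap φ :=
      SetLike.lt_iff_le_and_exists.mpr ⟨fun a ha => hspan.2 ⟨a, ha, rfl⟩, x, hspan.1, hxP⟩
    have heq : Q.comap φ = N.comap φ :=
      (Ideal.comap_mono hQN).eq_of_not_lt (hsat _ (hQ.comap φ) hPQ)
    exact hmin.2 ⟨hQ, Ideal.map_le_iff_le_comap.mpr heq.ge⟩ hQN

/-- The maximal ideal of the completion of a Noetherian local ring is extended from the base. -/
theorem maximalIdeal_eq_map_of_ringEquiv_adicCompletion {A T : Type*} [CommRing A] [IsLocalRing A]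
    [IsNoetherianRing A] [CommRing T] [IsLocalRing T] (φ : A →+* T)
    (e : AdicCompletion (maximalIdeal A) A ≃+* T)
    (he : ∀ a : A, e (algebraMap A (AdicCompletion (maximalIdeal A) A) a) = φ a) :
    maximalIdeal T = (maximalIdeal A).map φ := by
  have hφ : φ = (e : AdicCompletion (maximalIdeal A) A →+* T).comp (algebraMap A _) :=
    RingHom.ext fun a => (he a).symm
  rw [hφ, ← Ideal.map_map, ← AdicCompletion.maximalIdeal_eq_map]
  exact (IsLocalRing.eq_maximalIdeal (Ideal.map_isMaximal_of_equiv e)).symm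

/-- Lemma: let `A` be a Noetherian local domain whose completion is `T`, and let
`P₀ ⊊ P₁ ⊊ ⋯ ⊊ P_{n-1} ⊊ M` be a chain of primes of `T` of length `n ≥ 2` with
`P₀ ∩ A = (0)`.  If the chain of contractions has length strictly less than `n`
(i.e. two consecutive contractions coincide), then the chain of distinct contracted
primes is not saturated in `A`: some adjacent pair of distinct contracted primes admits
a prime strictly between them. -/
theorem stmt3 (A T : Type) [CommRing A] [IsDomain A] [IsLocalRing A] [IsNoetherianRing A]
    [CommRing T] [IsLocalRing T] [IsNoetherianRing T] [Algebra A T]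
    -- `T` is the completion of `A`, compatibly with the algebra map
    (hcompl : ∃ e : AdicCompletion (maximalIdeal A) A ≃+* T,
      ∀ a : A, e (algebraMap A (AdicCompletion (maximalIdeal A) A) a) = algebraMap A T a)
    (n : ℕ) (hn : 2 ≤ n)
    (f : Fin (n + 1) → PrimeSpectrum T) (hchain : StrictMono f)
    (hlast : (f (Fin.last n)).asIdeal = maximalIdeal T)
    (h0 : ((f 0).asIdeal).comap (algebraMap A T) = ⊥)
    -- the contracted chain has length strictly less than `n`:
    (hshort : ∃ i : Fin n, ((f i.castSucc).asIdeal).comap (algebraMap A T)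
      = ((f i.succ).asIdeal).comap (algebraMap A T)) :
    ∃ i j : Fin (n + 1), i < j ∧
      ((f i).asIdeal).comap (algebraMap A T) < ((f j).asIdeal).comap (algebraMap A T) ∧
      (∀ k : Fin (n + 1), i ≤ k → k ≤ j →
        ((f k).asIdeal).comap (algebraMap A T) = ((f i).asIdeal).comap (algebraMap A T) ∨
        ((f k).asIdeal).comap (algebraMap A T) = ((f j).asIdeal).comap (algebraMap A T)) ∧
      ∃ Q : Ideal A, Q.IsPrime ∧
        ((f i).asIdeal).comap (algebraMap A T) < Q ∧
        Q < ((f j).asIdeal).comap (algebraMap A T) := by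
  obtain ⟨e, he⟩ := hcompl
  have hM := maximalIdeal_eq_map_of_ringEquiv_adicCompletion (algebraMap A T) e he
  by_contra! H
  have hmono (k : Fin n) : f k.castSucc < f k.succ := hchain k.castSucc_lt_succ
  have hle (k : Fin n) : ((f k.castSucc).asIdeal).comap (algebraMap A T) ≤
      ((f k.succ).asIdeal).comap (algebraMap A T) := Ideal.comap_mono (hmono k).le
  have hne (k : Fin n)
      (hk : (f k.succ).asIdeal ∈
        (((f k.succ).asIdeal.comap (algebraMap A T)).map (algebraMap A T)).minimalPrimes) :
      ((f k.castSucc).asIdeal).comap (algebraMap A T) ≠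
        ((f k.succ).asIdeal).comap (algebraMap A T) := fun h =>
    (hmono k).not_ge <| hk.2 ⟨(f k.castSucc).isPrime, h ▸ Ideal.map_comap_le⟩ (hmono k).le
  have hmin (k : Fin (n + 1)) : (f k).asIdeal ∈
      (((f k).asIdeal.comap (algebraMap A T)).map (algebraMap A T)).minimalPrimes := by
    induction k using Fin.reverseInduction with
    | last =>
      rw [hlast]
      refine ⟨⟨inferInstance, Ideal.map_comap_le⟩, fun Q hQ _ => ?_⟩
      refine le_trans (hM.le.trans (Ideal.map_mono ?_)) hQ.2
      exact Ideal.map_le_iff_le_comap.mp hM.ge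
    | cast k ih =>
      refine mem_minimalPrimes_map_comap_of_lt _ (hmono k) ((hle k).lt_of_ne (hne k ih)) ?_ ih
      refine H _ _ k.castSucc_lt_succ ((hle k).lt_of_ne (hne k ih)) fun l hl hlu => ?_
      rcases hl.eq_or_lt with rfl | hl
      · exact .inl rfl
      · rw [le_antisymm hlu (Fin.castSucc_lt_iff_succ_le.mp hl)]
        exact .inr rfl
  obtain ⟨i, hi⟩ := hshort
  exact hne i (hmin _) hi
end

section
/- Let (T,M) be a complete Noetherian local ring and A a Noetherian local domain whose completion is isomorphic to T. If A contains a saturated chain of prime ideals of length n from (0) to its maximal ideal, then there exists a minimal prime P of T with dim(T/P) = n. -/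
open IsLocalRing

/-- `HasRegularSequence R k N`: the maximal ideal of `R` contains an `N`-regular sequence
of length `k`. -/
def HasRegularSequence (R : Type) [CommRing R] [IsLocalRing R] :
    ℕ → (N : Type) → [AddCommGroup N] → [Module R N] → Prop
  | 0, _, _, _ => True
  | k + 1, N, _, _ =>
    ∃ x ∈ maximalIdeal R, IsSMulRegular N x ∧ HasRegularSequence R k (QuotSMulTop x N)

section Depth

variable {R : Type} [CommRing R]

theorem HasRegularSequence.congr [IsLocalRing R] {k : ℕ} {N N' : Type} [AddCommGroup N]
    [Module R N] [AddCommGroup N'] [Module R N'] (e : N ≃ₗ[R] N')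
    (h : HasRegularSequence R k N) : HasRegularSequence R k N' := by
  induction k generalizing N N' with
  | zero => trivial
  | succ k ih =>
    obtain ⟨x, hx, hreg, hk⟩ := h
    exact ⟨x, hx, (e.isSMulRegular_congr x).1 hreg, ih (QuotSMulTop.congr x e) hk⟩

theorem quotSMulTop_mk_eq_zero_iff {N : Type} [AddCommGroup N] [Module R N] {x : R} {n : N} :
    (Submodule.Quotient.mk n : QuotSMulTop x N) = 0 ↔ ∃ u, x • u = n := by
  rw [Submodule.Quotient.mk_eq_zero, Submodule.mem_smul_pointwise_iff_exists]
  simp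

open scoped Pointwise in
/-- Taking quotients by two ring elements commutes. -/
noncomputable def quotSMulTopComm (N : Type) [AddCommGroup N] [Module R N] (x y : R) :
    QuotSMulTop x (QuotSMulTop y N) ≃ₗ[R] QuotSMulTop y (QuotSMulTop x N) := by
  have aux : ∀ x y : R, x • (⊤ : Submodule R (QuotSMulTop y N)) ≤
      LinearMap.ker (QuotSMulTop.map y (Submodule.mkQ (x • (⊤ : Submodule R N)))) := by
    rintro x y _ hz
    obtain ⟨w, -, rfl⟩ := (Submodule.mem_smul_pointwise_iff_exists _ _ _).1 hz
    obtain ⟨w, rfl⟩ := Submodule.Quotient.mk_surjective _ w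
    rw [LinearMap.mem_ker, map_smul, QuotSMulTop.map_apply_mk]
    have : x • (Submodule.mkQ (x • (⊤ : Submodule R N)) w) = 0 := by
      rw [← map_smul, Submodule.mkQ_apply, quotSMulTop_mk_eq_zero_iff]
      exact ⟨w, rfl⟩
    rw [← Submodule.Quotient.mk_smul, this, Submodule.Quotient.mk_zero]
  refine LinearEquiv.ofLinearMap (Submodule.liftQ _ _ (aux x y)) (Submodule.liftQ _ _ (aux y x)) ?_ ?_
  · ext n; rfl
  · ext n; rfl

theorem isSMulRegular_quotSMulTop_swap {N : Type} [AddCommGroup N] [Module R N] {x z : R}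
    (hx : IsSMulRegular N x)
    (hzx : IsSMulRegular (QuotSMulTop x N) z) : IsSMulRegular (QuotSMulTop z N) x := by
  rw [isSMulRegular_iff_right_eq_zero_of_smul] at *
  intro n hn
  obtain ⟨u, rfl⟩ := Submodule.Quotient.mk_surjective _ n
  rw [← Submodule.Quotient.mk_smul, quotSMulTop_mk_eq_zero_iff] at hn
  obtain ⟨v, hv⟩ := hn
  have h1 : (Submodule.Quotient.mk v : QuotSMulTop x N) = 0 := by
    apply hzx
    rw [← Submodule.Quotient.mk_smul, quotSMulTop_mk_eq_zero_iff]
    exact ⟨u, hv.symm⟩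
  obtain ⟨w, rfl⟩ := quotSMulTop_mk_eq_zero_iff.1 h1
  rw [quotSMulTop_mk_eq_zero_iff]
  refine ⟨w, ?_⟩
  have : x • (u - z • w) = 0 := by rw [smul_sub, ← hv, smul_comm, sub_self]
  exact (sub_eq_zero.1 (hx _ this)).symm

variable [IsNoetherianRing R]

theorem exists_mem_associatedPrimes_of_forall_not_isSMulRegular {N : Type} [AddCommGroup N]
    [Module R N] [Module.Finite R N] {I : Ideal R} (h : ∀ x ∈ I, ¬ IsSMulRegular N x) :
    ∃ p ∈ associatedPrimes R N, I ≤ p := by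
  have h2 : (I : Set R) ⊆ ⋃ p ∈ associatedPrimes R N, (p : Set R) := by
    rw [biUnion_associatedPrimes_eq_compl_regular]
    exact h
  exact (Ideal.subset_union_prime_finite (associatedPrimes.finite R N) ⊤ ⊤
    fun p hp _ _ ↦ IsAssociatedPrime.isPrime hp).1 h2

theorem not_mem_of_mem_associatedPrimes {N : Type} [AddCommGroup N] [Module R N] {p : Ideal R}
    (hp : p ∈ associatedPrimes R N) {x : R} (hx : IsSMulRegular N x) : x ∉ p := by
  intro hxp
  have : x ∈ ⋃ p ∈ associatedPrimes R N, (p : Set R) := Set.mem_biUnion hp hxp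
  rw [biUnion_associatedPrimes_eq_compl_regular] at this
  exact this hx

theorem mem_support_of_mem_associatedPrimes {N : Type} [AddCommGroup N] [Module R N]
    {p : PrimeSpectrum R} (hp : p.asIdeal ∈ associatedPrimes R N) : p ∈ Module.support R N := by
  obtain ⟨-, n, hn⟩ := isAssociatedPrime_iff.1 hp
  rw [Module.mem_support_iff_exists_annihilator]
  refine ⟨n, fun r hr ↦ ?_⟩
  rw [Submodule.mem_annihilator_span_singleton] at hr
  rw [hn]
  simpa [Submodule.mem_colon_singleton] using hr

theorem exists_mem_associatedPrimes_le_of_mem_support {N : Type} [AddCommGroup N] [Module R N]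
    [Module.Finite R N] {q : PrimeSpectrum R} (hq : q ∈ Module.support R N) :
    ∃ p : PrimeSpectrum R, p.asIdeal ∈ associatedPrimes R N ∧ p ≤ q := by
  obtain ⟨p, hp, hpq⟩ := Ideal.exists_minimalPrimes_le (Module.annihilator_le_of_mem_support hq)
  exact ⟨⟨p, hp.1.1⟩,
    Module.associatedPrimes.minimalPrimes_annihilator_subset_associatedPrimes R N hp, hpq⟩

/-- If `x` is `N`-regular, an associated prime `p` of `N` contained in a prime `q` containing `x`
lies strictly below an associated prime of `N / xN` contained in `q`. -/
theorem exists_mem_associatedPrimes_quotSMulTop {N : Type} [AddCommGroup N] [Module R N]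
    [Module.Finite R N] {x : R} (hx : IsSMulRegular N x) {p q : PrimeSpectrum R}
    (hp : p.asIdeal ∈ associatedPrimes R N) (hpq : p ≤ q) (hxq : x ∈ q.asIdeal) :
    ∃ p' : PrimeSpectrum R, p'.asIdeal ∈ associatedPrimes R (QuotSMulTop x N) ∧
      p < p' ∧ p' ≤ q := by
  let N' := Submodule.torsionBySet R N (p.asIdeal : Set R)
  have hpN' : p ∈ Module.support R N' := by
    obtain ⟨-, n, hn⟩ := isAssociatedPrime_iff.1 hp
    have hmem : n ∈ N' := by
      rw [Submodule.mem_torsionBySet_iff]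
      rintro ⟨a, ha⟩
      have ha' : a ∈ p.asIdeal := ha
      rw [hn] at ha'
      simpa [Submodule.mem_colon_singleton] using ha'
    rw [Module.mem_support_iff_exists_annihilator]
    refine ⟨⟨n, hmem⟩, fun r hr ↦ ?_⟩
    rw [Submodule.mem_annihilator_span_singleton] at hr
    rw [hn]
    simpa [Submodule.mem_colon_singleton, Subtype.ext_iff] using hr
  have hq : q ∈ Module.support R (QuotSMulTop x N') := by
    rw [Module.support_quotSMulTop]
    exact ⟨Module.mem_support_mono hpq hpN', by simpa using hxq⟩
  obtain ⟨p', hp', hp'q⟩ := exists_mem_associatedPrimes_le_of_mem_support hq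
  have hann := Module.annihilator_le_of_mem_support (mem_support_of_mem_associatedPrimes hp')
  have hinj : Function.Injective (QuotSMulTop.map x N'.subtype) := by
    rw [injective_iff_map_eq_zero]
    intro a ha
    obtain ⟨u, rfl⟩ := Submodule.Quotient.mk_surjective _ a
    rw [QuotSMulTop.map_apply_mk, quotSMulTop_mk_eq_zero_iff] at ha
    obtain ⟨v, hv⟩ := ha
    have hvN : v ∈ N' := by
      rw [Submodule.mem_torsionBySet_iff]
      rintro ⟨a, ha⟩
      refine (isSMulRegular_iff_right_eq_zero_of_smul).1 hx _ ?_
      have := (Submodule.mem_torsionBySet_iff _ _).1 u.2 ⟨a, ha⟩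
      simp only at this ⊢
      rw [smul_comm, hv]
      exact this
    exact quotSMulTop_mk_eq_zero_iff.2 ⟨⟨v, hvN⟩, Subtype.ext hv⟩
  refine ⟨p', associatedPrimes.subset_of_injective hinj hp', lt_of_le_of_ne ?_ ?_, hp'q⟩
  · intro a ha
    apply hann
    rw [Module.mem_annihilator]
    intro b
    obtain ⟨u, rfl⟩ := Submodule.Quotient.mk_surjective _ b
    rw [← Submodule.Quotient.mk_smul]
    have : a • u = 0 := Subtype.ext ((Submodule.mem_torsionBySet_iff _ _).1 u.2 ⟨a, ha⟩)
    rw [this, Submodule.Quotient.mk_zero]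
  · rintro rfl
    exact not_mem_of_mem_associatedPrimes hp hx (hann (QuotSMulTop.mem_annihilator _ x))

variable [IsLocalRing R]

theorem maximalIdeal_mem_associatedPrimes_quotSMulTop_swap {N : Type} [AddCommGroup N]
    [Module R N] {x y : R} (hym : y ∈ maximalIdeal R)
    (hx : IsSMulRegular N x) (hy : IsSMulRegular N y)
    (h : maximalIdeal R ∈ associatedPrimes R (QuotSMulTop x N)) :
    maximalIdeal R ∈ associatedPrimes R (QuotSMulTop y N) := by
  obtain ⟨-, n, hn⟩ := isAssociatedPrime_iff.1 h
  obtain ⟨u, rfl⟩ := Submodule.Quotient.mk_surjective _ n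
  have hu : ∀ m ∈ maximalIdeal R, ∃ w, x • w = m • u := by
    intro m hm
    rw [hn] at hm
    rw [← quotSMulTop_mk_eq_zero_iff, Submodule.Quotient.mk_smul]
    simpa [Submodule.mem_colon_singleton] using hm
  obtain ⟨v, hv⟩ := hu y hym
  rw [isSMulRegular_iff_right_eq_zero_of_smul] at hx hy
  have hle : maximalIdeal R ≤
      (⊥ : Submodule R (QuotSMulTop y N)).colon {Submodule.Quotient.mk v} := by
    intro m hm
    rw [Submodule.mem_colon_singleton, Submodule.mem_bot, ← Submodule.Quotient.mk_smul,
      quotSMulTop_mk_eq_zero_iff]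
    obtain ⟨w, hw⟩ := hu m hm
    refine ⟨w, sub_eq_zero.1 (hx _ ?_)⟩
    rw [smul_sub, smul_comm x y, hw, smul_comm x m, hv, smul_comm, sub_self]
  refine isAssociatedPrime_iff.2 ⟨inferInstance, Submodule.Quotient.mk v, ?_⟩
  refine ((maximalIdeal.isMaximal R).eq_of_le ?_ hle)
  intro htop
  have h1 : (1 : R) ∈ (⊥ : Submodule R (QuotSMulTop y N)).colon {Submodule.Quotient.mk v} := by
    rw [htop]; trivial
  rw [Submodule.mem_colon_singleton, Submodule.mem_bot, one_smul,
    quotSMulTop_mk_eq_zero_iff] at h1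
  obtain ⟨w, rfl⟩ := h1
  have h2 : u = x • w := by
    refine sub_eq_zero.1 (hy _ ?_)
    rw [smul_sub, ← hv, smul_comm, sub_self]
  have h3 : (1 : R) ∈ maximalIdeal R := by
    rw [hn, Submodule.mem_colon_singleton, Submodule.mem_bot, one_smul,
      quotSMulTop_mk_eq_zero_iff]
    exact ⟨w, h2.symm⟩
  exact (Ideal.ne_top_iff_one _).1 (maximalIdeal.isMaximal R).ne_top h3

theorem exists_isSMulRegular_three {N₁ N₂ N₃ : Type} [AddCommGroup N₁] [Module R N₁]
    [Module.Finite R N₁] [AddCommGroup N₂] [Module R N₂] [Module.Finite R N₂] [AddCommGroup N₃]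
    [Module R N₃] [Module.Finite R N₃] (h₁ : maximalIdeal R ∉ associatedPrimes R N₁)
    (h₂ : maximalIdeal R ∉ associatedPrimes R N₂) (h₃ : maximalIdeal R ∉ associatedPrimes R N₃) :
    ∃ z ∈ maximalIdeal R, IsSMulRegular N₁ z ∧ IsSMulRegular N₂ z ∧ IsSMulRegular N₃ z := by
  by_contra! hcon
  have hass : ∀ p, p ∈ associatedPrimes R (N₁ × N₂ × N₃) ↔
      p ∈ associatedPrimes R N₁ ∨ p ∈ associatedPrimes R N₂ ∨ p ∈ associatedPrimes R N₃ := by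
    intro p
    rw [associatedPrimes.prod, associatedPrimes.prod]
    rfl
  obtain ⟨p, hp, hle⟩ := exists_mem_associatedPrimes_of_forall_not_isSMulRegular
    (N := N₁ × N₂ × N₃) (I := maximalIdeal R) (by
      intro x hx hreg
      refine hcon x hx ?_ ?_ ?_
      · intro a b hab
        have := @hreg (a, 0, 0) (b, 0, 0) (by simpa using hab)
        simpa using this
      · intro a b hab
        have := @hreg (0, a, 0) (0, b, 0) (by simpa using hab)
        simpa using this
      · intro a b hab
        have := @hreg (0, 0, a) (0, 0, b) (by simpa using hab)
        simpa using this)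
  have hpm : maximalIdeal R = p :=
    (maximalIdeal.isMaximal R).eq_of_le (IsAssociatedPrime.isPrime hp).ne_top hle
  subst hpm
  rcases (hass _).1 hp with h | h | h
  · exact h₁ h
  · exact h₂ h
  · exact h₃ h

/-- Every regular element starts a regular sequence of the largest length. -/
theorem HasRegularSequence.quotSMulTop {k : ℕ} {N : Type} [AddCommGroup N] [Module R N]
    [Module.Finite R N] (h : HasRegularSequence R (k + 1) N) {x : R} (hxm : x ∈ maximalIdeal R)
    (hx : IsSMulRegular N x) : HasRegularSequence R k (QuotSMulTop x N) := by
  induction k generalizing N x with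
  | zero => trivial
  | succ k ih =>
    obtain ⟨y, hym, hy, hk⟩ := h
    have hNy : maximalIdeal R ∉ associatedPrimes R (QuotSMulTop y N) := by
      obtain ⟨z, hzm, hz, -⟩ := hk
      exact fun hmem ↦ not_mem_of_mem_associatedPrimes hmem hz hzm
    have hNx : maximalIdeal R ∉ associatedPrimes R (QuotSMulTop x N) := fun hmem ↦
      hNy (maximalIdeal_mem_associatedPrimes_quotSMulTop_swap hym hx hy hmem)
    have hN : maximalIdeal R ∉ associatedPrimes R N := fun hmem ↦
      not_mem_of_mem_associatedPrimes hmem hx hxm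
    obtain ⟨z, hzm, hzN, hzx, hzy⟩ := exists_isSMulRegular_three hN hNx hNy
    have h1 : HasRegularSequence R (k + 1) (QuotSMulTop z N) :=
      ⟨y, hym, isSMulRegular_quotSMulTop_swap hy hzy,
        (ih hk hzm hzy).congr (quotSMulTopComm N z y)⟩
    exact ⟨z, hzm, hzx, (ih h1 hxm (isSMulRegular_quotSMulTop_swap hx hzx)).congr
      (quotSMulTopComm N x z)⟩

theorem HasRegularSequence.le_coheight {k : ℕ} {N : Type} [AddCommGroup N] [Module R N]
    [Module.Finite R N] (h : HasRegularSequence R k N) {p : PrimeSpectrum R}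
    (hp : p.asIdeal ∈ associatedPrimes R N) : (k : ℕ∞) ≤ Order.coheight p := by
  induction k generalizing N p with
  | zero => simp
  | succ k ih =>
    obtain ⟨x, hxm, hx, hk⟩ := h
    obtain ⟨p', hp', hlt, -⟩ := exists_mem_associatedPrimes_quotSMulTop hx hp
      (q := closedPoint R) (IsLocalRing.le_maximalIdeal p.2.ne_top) hxm
    have := ih hk hp'
    push_cast
    exact (add_le_add_left this 1).trans (Order.coheight_add_one_le hlt)

/-- A finite module of depth at least `e` whose support has dimension at most `e`. -/
structure IsCohenMacaulayOfDim (R : Type) [CommRing R] [IsLocalRing R] (e : ℕ) (N : Type)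
    [AddCommGroup N] [Module R N] : Prop where
  hasRegularSequence : HasRegularSequence R e N
  coheight_le : ∀ p ∈ Module.support R N, Order.coheight p ≤ (e : ℕ∞)

namespace IsCohenMacaulayOfDim

variable {e : ℕ} {N : Type} [AddCommGroup N] [Module R N] [Module.Finite R N]

theorem coheight_add_one_le (h : IsCohenMacaulayOfDim R e N) {x : R} (hx : IsSMulRegular N x)
    {p : PrimeSpectrum R} (hp : p ∈ Module.support R (QuotSMulTop x N)) :
    Order.coheight p + 1 ≤ (e : ℕ∞) := by
  rw [Module.support_quotSMulTop] at hp
  obtain ⟨q, hq, hqp⟩ := exists_mem_associatedPrimes_le_of_mem_support hp.1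
  have hlt : q < p := lt_of_le_of_ne hqp (by
    rintro rfl
    exact not_mem_of_mem_associatedPrimes hq hx (by simpa using hp.2))
  exact (Order.coheight_add_one_le hlt).trans
    (h.coheight_le q (mem_support_of_mem_associatedPrimes hq))

theorem quotSMulTop (h : IsCohenMacaulayOfDim R (e + 1) N) {x : R} (hxm : x ∈ maximalIdeal R)
    (hx : IsSMulRegular N x) : IsCohenMacaulayOfDim R e (QuotSMulTop x N) where
  hasRegularSequence := h.hasRegularSequence.quotSMulTop hxm hx
  coheight_le p hp := by
    have := h.coheight_add_one_le hx hp
    push_cast at this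
    exact (ENat.add_le_add_iff_right ENat.one_ne_top).1 this

theorem coheight_eq (h : IsCohenMacaulayOfDim R e N) {p : PrimeSpectrum R}
    (hp : p.asIdeal ∈ associatedPrimes R N) : Order.coheight p = e :=
  le_antisymm (h.coheight_le p (mem_support_of_mem_associatedPrimes hp))
    (h.hasRegularSequence.le_coheight hp)

theorem exists_mem_associatedPrimes (h : IsCohenMacaulayOfDim R e N) {p : PrimeSpectrum R}
    (hp : p ∈ Module.support R N) :
    ∃ (e' : ℕ) (N' : Type) (_ : AddCommGroup N') (_ : Module R N') (_ : Module.Finite R N'),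
      IsCohenMacaulayOfDim R e' N' ∧ p.asIdeal ∈ associatedPrimes R N' := by
  induction e generalizing N with
  | zero =>
    obtain ⟨q, hq, hqp⟩ := exists_mem_associatedPrimes_le_of_mem_support hp
    obtain rfl : q = p := by
      by_contra hne
      have h1 := Order.coheight_add_one_le (lt_of_le_of_ne hqp hne)
      rw [h.coheight_eq hq] at h1
      simp at h1
    exact ⟨0, N, _, _, inferInstance, h, hq⟩
  | succ e ih =>
    by_cases hreg : ∃ x ∈ p.asIdeal, IsSMulRegular N x
    · obtain ⟨x, hxp, hx⟩ := hreg
      refine ih (h.quotSMulTop (IsLocalRing.le_maximalIdeal p.2.ne_top hxp) hx) ?_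
      rw [Module.support_quotSMulTop]
      exact ⟨hp, by simpa using hxp⟩
    · push Not at hreg
      obtain ⟨q, hq, hpq⟩ := exists_mem_associatedPrimes_of_forall_not_isSMulRegular hreg
      let q' : PrimeSpectrum R := ⟨q, IsAssociatedPrime.isPrime hq⟩
      have hpq' : p ≤ q' := hpq
      obtain rfl : p = q' := by
        by_contra hne
        have h1 := Order.coheight_add_one_le (lt_of_le_of_ne hpq' hne)
        rw [h.coheight_eq hq] at h1
        have h2 := h1.trans (h.coheight_le p hp)
        exact absurd h2 (not_le.2 (by exact_mod_cast Nat.lt_succ_self _))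
      exact ⟨e + 1, N, _, _, inferInstance, h, hq⟩

theorem coheight_eq_add_one_of_covBy (h : IsCohenMacaulayOfDim R e N) {p q : PrimeSpectrum R}
    (hp : p.asIdeal ∈ associatedPrimes R N) (hpq : p ⋖ q) :
    Order.coheight p = Order.coheight q + 1 := by
  have hpe := h.coheight_eq hp
  by_cases hreg : ∃ x ∈ q.asIdeal, IsSMulRegular N x
  · obtain ⟨x, hxq, hx⟩ := hreg
    obtain ⟨p', hp', hlt, hle⟩ := exists_mem_associatedPrimes_quotSMulTop hx hp hpq.le hxq
    obtain rfl : p' = q := (lt_or_eq_of_le hle).resolve_left (hpq.2 hlt)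
    have h1 := h.coheight_add_one_le hx (mem_support_of_mem_associatedPrimes hp')
    obtain _ | e := e
    · simp at h1
    · rw [hpe, (h.quotSMulTop (IsLocalRing.le_maximalIdeal p'.2.ne_top hxq) hx).coheight_eq hp']
      push_cast
      rfl
  · push Not at hreg
    obtain ⟨r, hr, hqr⟩ := exists_mem_associatedPrimes_of_forall_not_isSMulRegular hreg
    let r' : PrimeSpectrum R := ⟨r, IsAssociatedPrime.isPrime hr⟩
    have hlt : p < r' := hpq.lt.trans_le hqr
    have h1 := Order.coheight_add_one_le hlt
    rw [h.coheight_eq hr, hpe] at h1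
    exact absurd h1 (not_le.2 (by exact_mod_cast Nat.lt_succ_self _))

end IsCohenMacaulayOfDim

theorem coheight_eq_add_one_of_covBy_of_isCohenMacaulay {d : ℕ} (h : IsCohenMacaulayOfDim R d R)
    {p q : PrimeSpectrum R} (hpq : p ⋖ q) : Order.coheight p = Order.coheight q + 1 := by
  have hp : p ∈ Module.support R R := by
    rw [Module.mem_support_iff_exists_annihilator]
    refine ⟨1, fun r hr ↦ ?_⟩
    rw [Submodule.mem_annihilator_span_singleton, smul_eq_mul, mul_one] at hr
    simp [hr]
  obtain ⟨e', N', _, _, _, hN', hass⟩ := h.exists_mem_associatedPrimes hp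
  exact hN'.coheight_eq_add_one_of_covBy hass hpq

end Depth

section RegularPowerSeries

open scoped Pointwise in
theorem HasRegularSequence.of_surjective {R S : Type} [CommRing R] [CommRing S] [IsLocalRing R]
    [IsLocalRing S] [Algebra R S] (hsurj : Function.Surjective (algebraMap R S)) {k : ℕ}
    {N : Type} [AddCommGroup N] [Module R N] [Module S N] [IsScalarTower R S N]
    (h : HasRegularSequence S k N) : HasRegularSequence R k N := by
  induction k generalizing N with
  | zero => trivial
  | succ k ih =>
    obtain ⟨y, hym, hy, hk⟩ := h
    obtain ⟨x, rfl⟩ := hsurj y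
    refine ⟨x, fun hx ↦ hym (hx.map _), fun a b hab ↦ hy (by simpa using hab),
      HasRegularSequence.congr ?_ (ih hk)⟩
    have : (algebraMap R S x • (⊤ : Submodule S N)).restrictScalars R =
        x • (⊤ : Submodule R N) := by
      ext n
      simp [Submodule.mem_smul_pointwise_iff_exists]
    exact (Submodule.Quotient.restrictScalarsEquiv R _).symm.trans
      (Submodule.quotEquivOfEq _ _ this)

open scoped Pointwise in
theorem HasRegularSequence.succ_of_surjective {R S : Type} [CommRing R] [CommRing S]
    [IsLocalRing R] [IsLocalRing S] {f : R →+* S} (hsurj : Function.Surjective f) {x : R}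
    (hx : IsSMulRegular R x) (hker : RingHom.ker f = Ideal.span {x}) {k : ℕ}
    (h : HasRegularSequence S k S) : HasRegularSequence R (k + 1) R := by
  algebraize [f]
  have hxm : x ∈ maximalIdeal R := by
    rw [mem_maximalIdeal]
    intro hu
    have h0 : f x = 0 := by
      rw [← RingHom.mem_ker, hker]
      exact Ideal.mem_span_singleton_self x
    exact not_isUnit_zero (h0 ▸ hu.map f)
  refine ⟨x, hxm, hx, HasRegularSequence.congr ?_ (HasRegularSequence.of_surjective hsurj h)⟩
  have : x • (⊤ : Submodule R R) = LinearMap.ker (Algebra.linearMap R S) := by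
    ext r
    have : r ∈ RingHom.ker f ↔ ∃ a, x * a = r := by
      rw [hker, Ideal.mem_span_singleton]
      exact ⟨fun ⟨a, ha⟩ ↦ ⟨a, ha.symm⟩, fun ⟨a, ha⟩ ↦ ⟨a, ha.symm⟩⟩
    rw [LinearMap.mem_ker, Submodule.mem_smul_pointwise_iff_exists]
    refine Iff.trans ?_ this.symm
    simp
  exact ((Submodule.quotEquivOfEq _ _ this).trans
    ((Algebra.linearMap R S).quotKerEquivOfSurjective hsurj)).symm

theorem ringKrullDim_le_add_one_of_surjective {R S : Type} [CommRing R] [CommRing S]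
    [IsLocalRing R] [IsNoetherianRing R] [IsLocalRing S] {f : R →+* S}
    (hsurj : Function.Surjective f) {x : R} (hker : RingHom.ker f = Ideal.span {x}) :
    ringKrullDim R ≤ ringKrullDim S + 1 := by
  have hxm : x ∈ maximalIdeal R := by
    rw [mem_maximalIdeal]
    intro hu
    have h0 : f x = 0 := by
      rw [← RingHom.mem_ker, hker]
      exact Ideal.mem_span_singleton_self x
    exact not_isUnit_zero (h0 ▸ hu.map f)
  have h1 := ringKrullDim_le_ringKrullDim_quotient_add_encard {x} (by
    rwa [IsLocalRing.ringJacobson_eq_maximalIdeal, Set.singleton_subset_iff])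
  rw [← hker, ringKrullDim_eq_of_ringEquiv (RingHom.quotientKerEquivOfSurjective hsurj)] at h1
  simpa using h1

theorem hasRegularSequence_mvPowerSeries {D : Type} [CommRing D] [IsLocalRing D]
    [IsNoetherianRing D] {d : ℕ} (h : HasRegularSequence D d D) (hd : ringKrullDim D ≤ d) (m : ℕ) :
    HasRegularSequence (MvPowerSeries (Fin m) D) (d + m) (MvPowerSeries (Fin m) D) ∧
      ringKrullDim (MvPowerSeries (Fin m) D) ≤ (d + m : ℕ) := by
  induction m with
  | zero =>
    let e := (MvPowerSeries.isEmptyEquiv (Fin 0) D).symm.toRingEquiv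
    refine ⟨?_, (ringKrullDim_eq_of_ringEquiv e).symm.trans_le hd⟩
    algebraize [e.symm.toRingHom]
    refine HasRegularSequence.congr (N := D) (AddEquiv.toLinearEquiv e.toAddEquiv fun r a ↦ ?_)
      (HasRegularSequence.of_surjective (S := D) e.symm.surjective h)
    change e (e.symm r * a) = r * e a
    rw [map_mul, e.apply_symm_apply]
  | succ m ih =>
    let e := (MvPowerSeries.finSuccEquiv D m).toRingEquiv
    let f : MvPowerSeries (Fin (m + 1)) D →+* MvPowerSeries (Fin m) D :=
      PowerSeries.constantCoeff.comp e.toRingHom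
    have hsurj : Function.Surjective f :=
      (PowerSeries.constantCoeff_surj).comp e.surjective
    have hker : RingHom.ker f = Ideal.span {MvPowerSeries.X 0} := by
      ext r
      rw [RingHom.mem_ker, Ideal.mem_span_singleton, ← map_dvd_iff e]
      have : e (MvPowerSeries.X 0) = PowerSeries.X := MvPowerSeries.finSuccEquiv_X_zero
      rw [this, PowerSeries.X_dvd_iff]
      rfl
    have hreg : IsSMulRegular (MvPowerSeries (Fin (m + 1)) D)
        (MvPowerSeries.X 0 : MvPowerSeries (Fin (m + 1)) D) := by
      intro a b hab
      apply e.injective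
      have := congrArg e hab
      have hX : e (MvPowerSeries.X 0) = PowerSeries.X := MvPowerSeries.finSuccEquiv_X_zero
      simp only [smul_eq_mul, map_mul, hX] at this
      exact PowerSeries.X_mul_cancel this
    refine ⟨ih.1.succ_of_surjective hsurj hreg hker,
      (ringKrullDim_le_add_one_of_surjective hsurj hker).trans ?_⟩
    exact (add_le_add_left ih.2 1).trans (by push_cast; rw [add_assoc])

theorem isCohenMacaulayOfDim_of_hasRegularSequence {R : Type} [CommRing R] [IsLocalRing R]
    {d : ℕ} (h : HasRegularSequence R d R) (hd : ringKrullDim R ≤ d) :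
    IsCohenMacaulayOfDim R d R where
  hasRegularSequence := h
  coheight_le p _ := by
    have := (Order.coheight_le_krullDim p).trans hd
    exact_mod_cast this

end RegularPowerSeries

section FormalSmoothness

open MvPolynomial in
theorem subsingleton_h1Cotangent_iff_mem_ker_sq (R S : Type*) [CommRing R] [CommRing S]
    [Algebra R S] :
    Subsingleton (Algebra.H1Cotangent R S) ↔
      ∀ f : MvPolynomial S R, aeval (id : S → S) f = 0 →
        (∀ i, aeval (id : S → S) (pderiv i f) = 0) →
        f ∈ RingHom.ker (aeval (R := R) (id : S → S)) ^ 2 := by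
  have hker : (Algebra.Generators.self R S).toExtension.ker =
      RingHom.ker (aeval (R := R) (id : S → S)) :=
    (Algebra.Generators.self R S).ker_eq_ker_aeval_val
  rw [Algebra.Extension.subsingleton_h1Cotangent, injective_iff_map_eq_zero]
  constructor
  · intro h f hf hd
    have hf' : f ∈ (Algebra.Generators.self R S).toExtension.ker := hker ▸ hf
    have := h (Algebra.Extension.Cotangent.mk ⟨f, hf'⟩) (by
      rw [Algebra.Extension.cotangentComplex_mk]
      apply (Algebra.Generators.self R S).cotangentSpaceBasis.repr.injective
      rw [map_zero]
      ext i
      exact ((Algebra.Generators.self R S).cotangentSpaceBasis_repr_one_tmul f i).trans (hd i))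
    rw [Algebra.Extension.Cotangent.mk_eq_zero_iff] at this
    rw [← hker]
    exact this
  · intro h x hx
    obtain ⟨⟨f, hf⟩, rfl⟩ := Algebra.Extension.Cotangent.mk_surjective x
    rw [Algebra.Extension.Cotangent.mk_eq_zero_iff]
    have hf' : f ∈ RingHom.ker (aeval (R := R) (id : S → S)) := hker ▸ hf
    have := h f hf' fun i ↦ by
      rw [Algebra.Extension.cotangentComplex_mk] at hx
      have h2 := (Algebra.Generators.self R S).cotangentSpaceBasis_repr_one_tmul f i
      refine h2.symm.trans ?_
      have h3 := congrArg (fun z ↦ (Algebra.Generators.self R S).cotangentSpaceBasis.repr z i) hx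
      simpa using h3
    rw [← hker] at this
    exact this

open MvPolynomial in
theorem formallySmooth_of_perfectField (K L : Type*) [Field K] [Field L] [Algebra K L]
    [PerfectField K] : Algebra.FormallySmooth K L := by
  refine ⟨inferInstance, (subsingleton_h1Cotangent_iff_mem_ker_sq K L).mpr fun f hf hd ↦ ?_⟩
  let F := IntermediateField.adjoin K (f.vars : Set L)
  have hsub : (f.vars : Set L) ⊆ Set.range (algebraMap F L) := fun x hx ↦
    ⟨⟨x, IntermediateField.subset_adjoin K _ hx⟩, rfl⟩
  obtain ⟨q, hqf⟩ := exists_rename_eq_of_vars_subset_range f (algebraMap F L)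
    (algebraMap F L).injective hsub
  rw [← hqf] at hf hd ⊢
  have hfg : F.FG := ⟨_, rfl⟩
  have : Algebra.EssFiniteType K F := IntermediateField.essFiniteType_iff.mpr hfg
  have hae (g : MvPolynomial F K) : aeval (id : L → L) (rename (algebraMap F L) g) =
      algebraMap F L (aeval (id : F → F) g) := by
    rw [aeval_rename, ← MvPolynomial.aeval_algebraMap_apply]
    rfl
  have h0 (g : MvPolynomial F K) (hg : aeval (id : L → L) (rename (algebraMap F L) g) = 0) :
      aeval (id : F → F) g = 0 := by
    rw [hae, map_eq_zero] at hg
    exact hg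
  have hq := (subsingleton_h1Cotangent_iff_mem_ker_sq K F).mp inferInstance q (h0 q hf)
    fun i ↦ h0 _ (by
      rw [← pderiv_rename (algebraMap F L).injective]
      exact hd _)
  have hmap := Ideal.mem_map_of_mem (rename (R := K) (algebraMap F L)) hq
  rw [Ideal.map_pow] at hmap
  refine Ideal.pow_right_mono (Ideal.map_le_iff_le_comap.mpr fun g hg ↦ ?_) 2 hmap
  rw [RingHom.mem_ker] at hg
  rw [Ideal.mem_comap, RingHom.mem_ker, hae, hg, map_zero]

end FormalSmoothness

section CoefficientLifting

theorem exists_coefficient_field_of_charZero (T : Type*) [CommRing T] [IsLocalRing T]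
    [IsAdicComplete (maximalIdeal T) T] [CharZero (ResidueField T)] :
    ∃ φ : ResidueField T →+* T, ∀ a, residue T (φ a) = a := by
  have hc (I : Ideal T) (hI : I ≠ ⊤) : CharZero (T ⧸ I) := by
    have : Nontrivial (T ⧸ I) := Ideal.Quotient.nontrivial_iff.mpr hI
    let f : T ⧸ I →+* ResidueField T := Ideal.Quotient.factor (le_maximalIdeal hI)
    exact f.charZero
  let : Algebra ℚ T := (EqualCharZero.nonempty_algebraRat_iff T).mpr hc |>.some
  let : Field (T ⧸ maximalIdeal T) := Ideal.Quotient.field _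
  have : Algebra.FormallySmooth ℚ (T ⧸ maximalIdeal T) := formallySmooth_of_perfectField _ _
  obtain ⟨g, hg⟩ := Algebra.FormallySmooth.exists_mkₐ_comp_eq_of_isAdicComplete
    (AlgHom.id ℚ (T ⧸ maximalIdeal T))
  exact ⟨g.toRingHom, fun a ↦ DFunLike.congr_fun hg a⟩

theorem exists_lift_of_sq_eq_zero {B B' D k : Type*} [CommRing B] [CommRing B'] [CommRing D]
    [Field k] (p : ℕ) [Fact p.Prime] [CharP k p] (r : D →+* k) (hr : Function.Surjective r)
    (hker : ∀ x, r x = 0 → (p : D) ∣ x) (hp : ∀ x : D, p * x = 0 → x = 0)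
    (π : B →+* B') (hπ : Function.Surjective π) (hsq : ∀ x y, π x = 0 → π y = 0 → x * y = 0)
    (hpJ : ∀ x, π x = 0 → p * x = 0) (g : D →+* B') :
    ∃ h : D →+* B, π.comp h = g := by
  let E : Subring (D × B) :=
    (g.comp (RingHom.fst D B)).eqLocus (π.comp (RingHom.snd D B))
  have hE (x : D × B) : x ∈ E ↔ g x.1 = π x.2 := Iff.rfl
  let q : E →+* D := (RingHom.fst D B).comp E.subtype
  have hrp : (r : D → k) p = 0 := by rw [map_natCast, CharP.cast_eq_zero]
  let I : Ideal E := Ideal.span {(p : E)}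
  let f : E ⧸ I →+* k := Ideal.Quotient.lift I (r.comp q) (by
    intro a ha
    obtain ⟨c, rfl⟩ := Ideal.mem_span_singleton'.mp ha
    simp [hrp])
  have hfmk (e : E) : f (Ideal.Quotient.mk I e) = r e.1.1 := Ideal.Quotient.lift_mk _ _ _
  have hlift (d : D) : ∃ e : E, e.1.1 = d := by
    obtain ⟨b, hb⟩ := hπ (g d)
    exact ⟨⟨(d, b), (hE _).mpr hb.symm⟩, rfl⟩
  have hf : Function.Surjective f := fun a ↦ by
    obtain ⟨d, rfl⟩ := hr a
    obtain ⟨e, rfl⟩ := hlift d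
    exact ⟨_, hfmk e⟩
  have hkerf (z : E ⧸ I) (hz : f z = 0) :
      ∃ e : E, e.1.1 = 0 ∧ Ideal.Quotient.mk I e = z := by
    obtain ⟨e, rfl⟩ := Ideal.Quotient.mk_surjective z
    rw [hfmk] at hz
    obtain ⟨d, hd⟩ := hker _ hz
    obtain ⟨e', rfl⟩ := hlift d
    refine ⟨e - p * e', by simp [hd], ?_⟩
    rw [Ideal.Quotient.eq, sub_sub_cancel_left, neg_mem_iff]
    exact Ideal.mul_mem_right _ _ (Ideal.mem_span_singleton_self _)
  have hJ (e : E) (he : e.1.1 = 0) : π e.1.2 = 0 := by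
    rw [← (hE _).mp e.2, he, map_zero]
  have hnil : IsNilpotent (RingHom.ker f) := by
    refine ⟨2, ?_⟩
    refine (sq (RingHom.ker f)).trans ?_
    rw [Ideal.zero_eq_bot, eq_bot_iff, Ideal.mul_le]
    intro x hx y hy
    obtain ⟨e, he, rfl⟩ := hkerf x hx
    obtain ⟨e', he', rfl⟩ := hkerf y hy
    have : e * e' = 0 := by
      ext
      · simp [he]
      · simpa using hsq _ _ (hJ e he) (hJ e' he')
    rw [Ideal.mem_bot, ← map_mul, this, map_zero]
  have : Nontrivial (E ⧸ I) := f.domain_nontrivial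
  have hpI : ((p : ℕ) : E ⧸ I) = 0 := by
    rw [← map_natCast (Ideal.Quotient.mk I), Ideal.Quotient.eq_zero_iff_mem]
    exact Ideal.mem_span_singleton_self _
  have : CharP (E ⧸ I) p := (CharP.charP_iff_prime_eq_zero Fact.out).mpr hpI
  let : Algebra (ZMod p) (E ⧸ I) := ZMod.algebra _ p
  let : Algebra (ZMod p) k := ZMod.algebra _ p
  have : Algebra.FormallySmooth (ZMod p) k := formallySmooth_of_perfectField _ _
  let f' : E ⧸ I →ₐ[ZMod p] k := ⟨f, fun x ↦ by
    exact DFunLike.congr_fun (Subsingleton.elim (f.comp (algebraMap _ _)) (algebraMap _ _)) x⟩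
  let s : k →ₐ[ZMod p] E ⧸ I :=
    Algebra.FormallySmooth.liftOfSurjective (AlgHom.id _ k) f' hf hnil
  have hs (a : k) : f (s a) = a :=
    Algebra.FormallySmooth.liftOfSurjective_apply (AlgHom.id _ k) f' hf hnil a
  let E' : Subring E := (Ideal.Quotient.mk I).eqLocus ((s : k →+* E ⧸ I).comp (r.comp q))
  have hE' (e : E) : e ∈ E' ↔ Ideal.Quotient.mk I e = s (r e.1.1) := Iff.rfl
  let q' : E' →+* D := q.comp E'.subtype
  have hq' : Function.Bijective q' := by
    constructor
    · rw [injective_iff_map_eq_zero]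
      rintro ⟨e, he⟩ h0
      have h0 : e.1.1 = 0 := h0
      rw [hE', h0, map_zero, map_zero, Ideal.Quotient.eq_zero_iff_mem] at he
      obtain ⟨c, hc⟩ := Ideal.mem_span_singleton'.mp he
      have hc1 : c.1.1 = 0 := hp _ (by rw [← h0, ← hc]; simp [mul_comm])
      have hc2 : e.1.2 = 0 := by
        rw [← hpJ _ (hJ c hc1), ← hc]
        simp [mul_comm]
      ext
      · exact h0
      · exact hc2
    · intro d
      obtain ⟨e, rfl⟩ := hlift d
      obtain ⟨j, hj, hj'⟩ := hkerf (Ideal.Quotient.mk I e - s (r e.1.1)) (by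
        rw [map_sub, hfmk, hs, sub_self])
      refine ⟨⟨e - j, ?_⟩, ?_⟩
      · rw [hE', map_sub, hj']
        simp [hj]
      · simp [q', q, hj]
  let e := RingEquiv.ofBijective q' hq'
  refine ⟨((RingHom.snd D B).comp (E.subtype.comp E'.subtype)).comp e.symm.toRingHom, ?_⟩
  ext d
  obtain ⟨x, rfl⟩ := e.surjective d
  simpa using! ((hE _).mp x.1.2).symm

theorem exists_ringHom_residue_comp_eq {D T : Type*} [CommRing D] [CommRing T] [IsLocalRing T]
    [IsAdicComplete (maximalIdeal T) T] (p : ℕ) [Fact p.Prime] [CharP (ResidueField T) p]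
    (r : D →+* ResidueField T) (hr : Function.Surjective r)
    (hker : ∀ x, r x = 0 → (p : D) ∣ x) (hp : ∀ x : D, p * x = 0 → x = 0) :
    ∃ φ : D →+* T, (residue T).comp φ = r := by
  set M := maximalIdeal T with hM
  have hpM : (p : T) ∈ M := by
    rw [hM, ← residue_eq_zero_iff, map_natCast, CharP.cast_eq_zero]
  have hsurj {m n : ℕ} (h : m ≤ n) : Function.Surjective (Ideal.Quotient.factorPow M h) :=
    Ideal.Quotient.factor_surjective _
  have step (n : ℕ) (g : D →+* T ⧸ M ^ (n + 1)) :
      ∃ h : D →+* T ⧸ M ^ (n + 1 + 1),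
        (Ideal.Quotient.factorPow M (n + 1).le_succ).comp h = g := by
    have hmem (x : T) : Ideal.Quotient.factorPow M (n + 1).le_succ (Ideal.Quotient.mk _ x) = 0 →
        x ∈ M ^ (n + 1) := fun h ↦ Ideal.Quotient.eq_zero_iff_mem.mp h
    refine exists_lift_of_sq_eq_zero p r hr hker hp _ (hsurj _) (fun x y hx hy ↦ ?_)
      (fun x hx ↦ ?_) g
    · obtain ⟨x, rfl⟩ := Ideal.Quotient.mk_surjective x
      obtain ⟨y, rfl⟩ := Ideal.Quotient.mk_surjective y
      rw [← map_mul, Ideal.Quotient.eq_zero_iff_mem]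
      refine Ideal.pow_le_pow_right (by lia : n + 1 + 1 ≤ (n + 1) + (n + 1)) ?_
      rw [pow_add]
      exact Ideal.mul_mem_mul (hmem x hx) (hmem y hy)
    · obtain ⟨x, rfl⟩ := Ideal.Quotient.mk_surjective x
      rw [← map_natCast (Ideal.Quotient.mk (M ^ (n + 1 + 1))), ← map_mul,
        Ideal.Quotient.eq_zero_iff_mem, pow_succ']
      exact Ideal.mul_mem_mul hpM (hmem x hx)
  choose next hnext using step
  let e : ResidueField T →+* T ⧸ M ^ (0 + 1) := Ideal.Quotient.factor (by simp [hM])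
  let F (n : ℕ) : D →+* T ⧸ M ^ (n + 1) :=
    Nat.rec (motive := fun n ↦ D →+* T ⧸ M ^ (n + 1)) (e.comp r) (fun n g ↦ next n g) n
  have hF (n : ℕ) : (Ideal.Quotient.factorPow M (n + 1).le_succ).comp (F (n + 1)) = F n :=
    hnext n (F n)
  have hmono : StrictMono fun n : ℕ ↦ n + 1 := fun a b h ↦ by simpa using h
  refine ⟨IsAdicComplete.StrictMono.liftRingHom M hmono F (hF _), ?_⟩
  ext x
  have h0 : Ideal.Quotient.mk (M ^ (0 + 1))
      (IsAdicComplete.StrictMono.liftRingHom M hmono F (hF _) x) = e (r x) :=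
    IsAdicComplete.StrictMono.mk_liftRingHom M hmono F (hF _) x
  obtain ⟨t, ht⟩ := residue_surjective (r x)
  rw [← ht] at h0 ⊢
  have h1 := Ideal.Quotient.eq.mp (h0 : _ = Ideal.Quotient.mk (M ^ (0 + 1)) t)
  rw [zero_add, pow_one] at h1
  exact Ideal.Quotient.eq.mpr h1

end CoefficientLifting

section CohenSubring

open Polynomial

variable {V K : Type*} [CommRing V] [Field K]

/-- The subring `C` has image in the subfield `k` and meets the kernel of `ρ` in `p C`. -/
def IsUnramifiedOver (p : ℕ) (ρ : V →+* K) (k : Subfield K) (C : Subring V) : Prop :=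
  (∀ c ∈ C, ρ c = 0 → ∃ d ∈ C, p * d = c) ∧ ∀ c ∈ C, ρ c ∈ k

theorem exists_maximal_isUnramifiedOver (p : ℕ) (ρ : V →+* K) [CharP K p] (k : Subfield K) :
    ∃ C, Maximal (IsUnramifiedOver p ρ k) C := by
  refine (zorn_le_nonempty₀ {C | IsUnramifiedOver p ρ k C} (fun c hc hchain y hy ↦ ?_) ⊥ ?_).imp
    fun C h ↦ h.2
  · have hmem {x : V} : x ∈ sSup c ↔ ∃ C ∈ c, x ∈ C :=
      Subring.mem_sSup_of_directedOn ⟨y, hy⟩ hchain.directedOn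
    refine ⟨sSup c, ⟨fun x hx h0 ↦ ?_, fun x hx ↦ ?_⟩, fun C hC ↦ le_sSup hC⟩
    · obtain ⟨C, hC, hxC⟩ := hmem.mp hx
      obtain ⟨d, hd, h⟩ := (hc hC).1 x hxC h0
      exact ⟨d, hmem.mpr ⟨C, hC, hd⟩, h⟩
    · obtain ⟨C, hC, hxC⟩ := hmem.mp hx
      exact (hc hC).2 x hxC
  · refine ⟨fun x hx h0 ↦ ?_, fun x hx ↦ ?_⟩
    · obtain ⟨n, rfl⟩ := Subring.mem_bot.mp hx
      rw [map_intCast, CharP.intCast_eq_zero_iff K p] at h0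
      obtain ⟨m, rfl⟩ := h0
      exact ⟨m, Subring.mem_bot.mpr ⟨m, rfl⟩, by simp⟩
    · obtain ⟨n, rfl⟩ := Subring.mem_bot.mp hx
      rw [map_intCast]
      exact intCast_mem k n

theorem IsUnramifiedOver.mem_of_mul_mem_of_maximal {p : ℕ} {ρ : V →+* K} {k : Subfield K}
    (hu : ∀ v, ρ v ≠ 0 → IsUnit v) {C : Subring V} (hC : Maximal (IsUnramifiedOver p ρ k) C)
    {s x : V} (hs : s ∈ C) (hs0 : ρ s ≠ 0) (hx : s * x ∈ C) : x ∈ C := by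
  let C' : Subring V :=
    { carrier := {x | ∃ s ∈ C, ρ s ≠ 0 ∧ s * x ∈ C}
      mul_mem' := by
        rintro a b ⟨s, hs, hs0, ha⟩ ⟨t, ht, ht0, hb⟩
        refine ⟨s * t, mul_mem hs ht, by simp [hs0, ht0], ?_⟩
        convert! mul_mem ha hb using 1
        ring
      one_mem' := ⟨1, one_mem _, by simp, by simp⟩
      add_mem' := by
        rintro a b ⟨s, hs, hs0, ha⟩ ⟨t, ht, ht0, hb⟩
        refine ⟨s * t, mul_mem hs ht, by simp [hs0, ht0], ?_⟩
        convert! add_mem (mul_mem ht ha) (mul_mem hs hb) using 1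
        ring
      zero_mem' := ⟨1, one_mem _, by simp, by simp⟩
      neg_mem' := by
        rintro a ⟨s, hs, hs0, ha⟩
        exact ⟨s, hs, hs0, by simpa using neg_mem ha⟩ }
  have hC' : IsUnramifiedOver p ρ k C' := by
    refine ⟨fun x hx h0 ↦ ?_, fun x hx ↦ ?_⟩
    · obtain ⟨s, hs, hs0, hx⟩ := hx
      obtain ⟨d, hd, h⟩ := hC.prop.1 _ hx (by simp [h0])
      obtain ⟨u, rfl⟩ := hu s hs0
      refine ⟨(u⁻¹ : Vˣ) * d, ⟨u, hs, hs0, by simpa using hd⟩, ?_⟩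
      rw [mul_left_comm, h, Units.inv_mul_cancel_left]
    · obtain ⟨s, hs, hs0, hx⟩ := hx
      have := mul_mem (inv_mem (hC.prop.2 s hs)) (hC.prop.2 _ hx)
      rwa [map_mul, inv_mul_cancel_left₀ hs0] at this
  exact hC.le_of_ge hC' (fun c hc ↦ ⟨1, one_mem _, by simp, by simpa using hc⟩)
    ⟨s, hs, hs0, hx⟩

theorem IsUnramifiedOver.exists_mem_of_maximal {p : ℕ} {ρ : V →+* K} {k : Subfield K}
    (hu : ∀ v, ρ v ≠ 0 → IsUnit v)
    (hroot : ∀ (f : V[X]) (α : K), f.Monic → (f.map ρ).eval α = 0 → ∃ a, f.eval a = 0 ∧ ρ a = α)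
    (hk : ∀ α ∈ k, ∃ a, ρ a = α)
    {C : Subring V} (hC : Maximal (IsUnramifiedOver p ρ k) C) {α : K} (hα : α ∈ k) :
    ∃ c ∈ C, ρ c = α := by
  let F : Subfield K :=
    { C.map ρ with
      inv_mem' := by
        rintro _ ⟨c, hc, rfl⟩
        by_cases h0 : ρ c = 0
        · exact ⟨0, C.zero_mem, by simp [h0]⟩
        · obtain ⟨u, rfl⟩ := hu c h0
          refine ⟨(u⁻¹ : Vˣ), ?_, ?_⟩
          · exact mem_of_mul_mem_of_maximal hu hC hc h0 (by simp)
          · exact eq_inv_of_mul_eq_one_left (by rw [← map_mul]; simp) }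
  have hF (c : C) : ρ c ∈ F := ⟨c, c.2, rfl⟩
  let σ : C →+* F := (ρ.comp C.subtype).codRestrict F hF
  have hσ : Function.Surjective σ := by
    rintro ⟨_, c, hc, rfl⟩
    exact ⟨⟨c, hc⟩, rfl⟩
  have hσρ : (algebraMap F K).comp σ = ρ.comp C.subtype := rfl
  have hdvd (g : C[X]) (hg : g.map σ = 0) : ∃ g' : C[X], Polynomial.C (p : C) * g' = g := by
    have : Polynomial.C (p : C) ∣ g := by
      rw [C_dvd_iff_dvd_coeff]
      intro i
      have h0 : ρ (g.coeff i) = 0 := by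
        have := congrArg (fun q ↦ ((q.coeff i : F) : K)) hg
        rw [coeff_map] at this
        exact this
      obtain ⟨d, hd, h⟩ := hC.prop.1 _ (g.coeff i).2 h0
      exact ⟨⟨d, hd⟩, Subtype.ext (by simp [h])⟩
    exact this.imp fun _ h ↦ h.symm
  have hev (g : C[X]) (a : V) (ha : ρ a = α) :
      ρ (g.eval₂ C.subtype a) = aeval α (g.map σ) := by
    rw [hom_eval₂, aeval_def, eval₂_map, hσρ, ha]
  have key (a : V) (ha : ρ a = α)
      (h : ∀ g : C[X], aeval α (g.map σ) = 0 →
        ∃ g' : C[X], p * g'.eval₂ C.subtype a = g.eval₂ C.subtype a) :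
      ∃ c ∈ C, ρ c = α := by
    refine ⟨a, ?_, ha⟩
    have hle : C ≤ (eval₂RingHom C.subtype a).range := fun c hc ↦
      ⟨Polynomial.C ⟨c, hc⟩, by simp⟩
    refine hC.le_of_ge ⟨?_, ?_⟩ hle ⟨X, by simp⟩
    · rintro _ ⟨g, rfl⟩ h0
      rw [coe_eval₂RingHom, hev g a ha] at h0
      obtain ⟨g', hg'⟩ := h g h0
      exact ⟨_, ⟨g', rfl⟩, hg'⟩
    · rintro _ ⟨g, rfl⟩
      rw [coe_eval₂RingHom, hom_eval₂, ha, eval₂_eq_sum_range]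
      exact sum_mem fun i _ ↦ mul_mem (hC.prop.2 _ (g.coeff i).2) (pow_mem hα i)
  by_cases halg : IsIntegral F α
  · have hmonic := minpoly.monic halg
    obtain ⟨f, hf, -, hfm⟩ := lifts_and_natDegree_eq_and_monic
      (map_surjective σ hσ (minpoly F α)) hmonic
    obtain ⟨a, haf, ha⟩ := hroot (f.map C.subtype) α (hfm.map _) (by
      rw [Polynomial.map_map, ← hσρ, ← Polynomial.map_map, hf, eval_map_algebraMap,
        minpoly.aeval])
    rw [eval_map] at haf
    refine key a ha fun g hg ↦ ?_
    have hr : (g %ₘ f).map σ = 0 := by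
      by_contra hne
      rw [map_modByMonic _ hfm, hf] at hne
      refine hne ((modByMonic_eq_zero_iff_dvd hmonic).mpr (minpoly.dvd F α hg))
    obtain ⟨g', hg'⟩ := hdvd _ hr
    refine ⟨g', ?_⟩
    conv_rhs => rw [← modByMonic_add_div g f, ← hg']
    simp [eval₂_mul, eval₂_add, haf]
  · obtain ⟨a, ha⟩ := hk α hα
    refine key a ha fun g hg ↦ ?_
    obtain ⟨g', hg'⟩ := hdvd g (by
      by_contra hne
      exact halg (IsAlgebraic.isIntegral ⟨_, hne, hg⟩))
    exact ⟨g', by simp [← hg', eval₂_mul]⟩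

theorem exists_eval_eq_zero_and_map_eq [IsDomain V] (ρ : V →+* K)
    (h : ∀ f : V[X], f.Monic → f.natDegree ≠ 0 → ∃ a, f.eval a = 0) (f : V[X]) (α : K)
    (hf : f.Monic) (hα : (f.map ρ).eval α = 0) : ∃ a, f.eval a = 0 ∧ ρ a = α := by
  induction hn : f.natDegree generalizing f with
  | zero =>
    rw [hf.natDegree_eq_zero.mp hn] at hα
    simp at hα
  | succ n ih =>
    obtain ⟨a, ha⟩ := h f hf (by lia)
    obtain ⟨q, rfl⟩ := dvd_iff_isRoot.mpr ha
    by_cases haα : ρ a = α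
    · exact ⟨a, ha, haα⟩
    · have hq : q.Monic := (monic_X_sub_C a).of_mul_monic_left hf
      rw [(monic_X_sub_C a).natDegree_mul hq, natDegree_X_sub_C] at hn
      obtain ⟨b, hb, hbα⟩ := ih q hq (by
        have : α - ρ a ≠ 0 := sub_ne_zero.mpr (Ne.symm haα)
        simpa [this] using hα) (by lia)
      exact ⟨b, by simp [hb], hbα⟩

end CohenSubring

section CohenRing

theorem exists_discreteValuationRing_of_dvd {C k : Type*} [CommRing C] [IsDomain C] [Field k]
    (p : ℕ) (r : C →+* k) (hr : Function.Surjective r) (hu : ∀ c, r c ≠ 0 → IsUnit c)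
    (hdvd : ∀ c, r c = 0 → (p : C) ∣ c) (hrp : (p : k) = 0) (hp : (p : C) ≠ 0) :
    ∃ (N : Ideal C) (_ : N.IsPrime) (s : C ⧸ N →+* k), IsDiscreteValuationRing (C ⧸ N) ∧
      Function.Surjective s ∧ (∀ x, s x = 0 → (p : C ⧸ N) ∣ x) ∧ (p : C ⧸ N) ≠ 0 := by
  have hpu : ¬ IsUnit (p : C) := fun h ↦ (h.map r).ne_zero (by simpa using hrp)
  let N : Ideal C :=
    { carrier := {c | ∀ n : ℕ, (p : C) ^ n ∣ c}
      add_mem' := fun ha hb n ↦ dvd_add (ha n) (hb n)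
      zero_mem' := fun n ↦ dvd_zero _
      smul_mem' := fun c x hx n ↦ (hx n).mul_left c }
  have hN (c : C) : c ∈ N ↔ ∀ n : ℕ, (p : C) ^ n ∣ c := Iff.rfl
  have hfac (c : C) (hc : c ∉ N) : ∃ n : ℕ, Associated ((p : C) ^ n) c := by
    rw [hN, not_forall] at hc
    classical
    have hpos : Nat.find hc ≠ 0 := fun h ↦ by simpa [h] using Nat.find_spec hc
    obtain ⟨n, hn⟩ := Nat.exists_eq_succ_of_ne_zero hpos
    have h1 := Nat.find_spec hc
    obtain ⟨u, rfl⟩ := not_not.mp (Nat.find_min hc (m := n) (by lia))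
    refine ⟨n, (hu u fun h0 ↦ h1 ?_).unit, rfl⟩
    rw [hn, pow_succ]
    exact mul_dvd_mul_left _ (hdvd u h0)
  have hpow (n : ℕ) : (p : C) ^ n ∉ N := fun h ↦ by
    have h := h (n + 1)
    rw [pow_succ] at h
    exact hpu (isUnit_of_dvd_one ((mul_dvd_mul_iff_left (pow_ne_zero n hp)).mp (by simpa using h)))
  have hprime : N.IsPrime := by
    refine ⟨(Ideal.ne_top_iff_one N).mpr (by simpa using hpow 0), fun {a b} hab ↦ ?_⟩
    by_contra! h
    obtain ⟨n, hn⟩ := hfac a h.1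
    obtain ⟨m, hm⟩ := hfac b h.2
    have := (hn.mul_mul hm).symm.dvd
    rw [← pow_add] at this
    exact hpow _ (N.mem_of_dvd this hab)
  have hs0 (a : C) (ha : a ∈ N) : r a = 0 := by
    obtain ⟨b, rfl⟩ := (by simpa using ha 1 : (p : C) ∣ a)
    simp [hrp]
  let s : C ⧸ N →+* k := Ideal.Quotient.lift N r hs0
  have hsu (x : C ⧸ N) (hx : s x ≠ 0) : IsUnit x := by
    obtain ⟨c, rfl⟩ := Ideal.Quotient.mk_surjective x
    exact (hu c hx).map _
  have hsdvd (x : C ⧸ N) (hx : s x = 0) : (p : C ⧸ N) ∣ x := by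
    obtain ⟨c, rfl⟩ := Ideal.Quotient.mk_surjective x
    simpa using map_dvd (Ideal.Quotient.mk N) (hdvd c hx)
  have hp0 : (p : C ⧸ N) ≠ 0 := fun h ↦ by
    rw [← map_natCast (Ideal.Quotient.mk N), Ideal.Quotient.eq_zero_iff_mem] at h
    exact hpow 1 (by simpa using h)
  have hpu' : ¬ IsUnit (p : C ⧸ N) := fun h ↦ (h.map s).ne_zero (by simpa using hrp)
  refine ⟨N, hprime, s, ?_, fun a ↦ ?_, hsdvd, hp0⟩
  · refine IsDiscreteValuationRing.ofHasUnitMulPowIrreducibleFactorization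
      ⟨p, ⟨hpu', fun a b hab ↦ ?_⟩, fun {x} hx ↦ ?_⟩
    · by_contra! h
      obtain ⟨c, rfl⟩ := hsdvd a (not_not.mp (mt (hsu a) h.1))
      obtain ⟨d, rfl⟩ := hsdvd b (not_not.mp (mt (hsu b) h.2))
      refine hpu' (IsUnit.of_mul_eq_one (c * d) (mul_left_cancel₀ hp0 ?_))
      linear_combination -hab
    · obtain ⟨c, rfl⟩ := Ideal.Quotient.mk_surjective x
      obtain ⟨n, hn⟩ := hfac c (fun h ↦ hx (Ideal.Quotient.eq_zero_iff_mem.mpr h))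
      exact ⟨n, by simpa using hn.map (Ideal.Quotient.mk N)⟩
  · obtain ⟨c, rfl⟩ := hr a
    exact ⟨Ideal.Quotient.mk N c, rfl⟩

theorem exists_valuationSubring_residue_embedding.{u} (k : Type u) [Field k] (p : ℕ) [Fact p.Prime]
    [CharP k p] :
    ∃ (L : Type u) (_ : Field L) (_ : IsAlgClosed L) (_ : CharZero L) (V : ValuationSubring L)
      (ι : k →+* ResidueField V), ∀ a, ∃ v, residue V v = ι a := by
  let R := MvPolynomial k ℤ
  let e : R →+* k := MvPolynomial.eval₂Hom (Int.castRingHom k) id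
  have he : Function.Surjective e := fun a ↦ ⟨MvPolynomial.X a, MvPolynomial.eval₂_X _ _ _⟩
  let P := RingHom.ker e
  have : P.IsPrime := RingHom.ker_isPrime e
  let F := FractionRing R
  let L := AlgebraicClosure F
  have hinj : Function.Injective (algebraMap R L) := by
    rw [IsScalarTower.algebraMap_eq R F L]
    exact (algebraMap F L).injective.comp (IsFractionRing.injective R F)
  have hunit (y : P.primeCompl) : IsUnit (algebraMap R L y) := by
    rw [isUnit_iff_ne_zero, Ne, map_eq_zero_iff _ hinj]
    exact fun h ↦ y.2 (h ▸ P.zero_mem)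
  obtain ⟨V, hV, hloc⟩ := IsLocalRing.exists_factor_valuationRing
    (IsLocalization.lift (S := Localization.AtPrime P) hunit)
  have : CharZero L := charZero_of_injective_ringHom hinj
  let g : Localization.AtPrime P →+* V := (IsLocalization.lift hunit).codRestrict V.toSubring hV
  have : IsLocalHom g := hloc
  let ρ : R →+* ResidueField V := (residue V).comp (g.comp (algebraMap R _))
  have hρ : RingHom.ker e ≤ RingHom.ker ρ := fun x hx ↦ by
    have h1 : algebraMap R (Localization.AtPrime P) x ∈ maximalIdeal _ :=
      (IsLocalization.AtPrime.to_map_mem_maximal_iff _ P x).mpr hx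
    refine (residue_eq_zero_iff _).mpr ?_
    exact map_nonunit g _ h1
  refine ⟨L, inferInstance, inferInstance, inferInstance, V, e.liftOfSurjective he ⟨ρ, hρ⟩, fun a ↦ ?_⟩
  obtain ⟨x, rfl⟩ := he a
  exact ⟨_, (e.liftOfRightInverse_comp_apply _ _ ⟨ρ, hρ⟩ x).symm⟩

theorem exists_discreteValuationRing_residueField.{u} (k : Type u) [Field k] (p : ℕ) [Fact p.Prime]
    [CharP k p] :
    ∃ (D : Type u) (_ : CommRing D) (_ : IsDomain D) (_ : IsDiscreteValuationRing D)
      (s : D →+* k), Function.Surjective s ∧ (∀ x, s x = 0 → (p : D) ∣ x) ∧ (p : D) ≠ 0 := by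
  obtain ⟨L, _, _, _, V, ι, hι⟩ := exists_valuationSubring_residue_embedding k p
  let ρ : V →+* ResidueField V := residue V
  have : CharP (ResidueField V) p := charP_of_injective_ringHom ι.injective p
  have hu (v : V) (hv : ρ v ≠ 0) : IsUnit v := (residue_ne_zero_iff_isUnit v).mp hv
  obtain ⟨C, hC⟩ := exists_maximal_isUnramifiedOver p ρ ι.fieldRange
  have hroot (f : Polynomial V) (hf : f.Monic) (hd : f.natDegree ≠ 0) : ∃ a, f.eval a = 0 := by
    obtain ⟨x, hx⟩ := IsAlgClosed.exists_root (f.map (algebraMap V L)) (fun h ↦ hd (by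
      rw [← hf.natDegree_map (algebraMap V L)]
      exact Polynomial.natDegree_eq_of_degree_eq_some h))
    rw [Polynomial.IsRoot.def, Polynomial.eval_map] at hx
    obtain ⟨a, rfl⟩ := IsIntegrallyClosed.isIntegral_iff.mp (⟨f, hf, hx⟩ : IsIntegral V x)
    refine ⟨a, ?_⟩
    rwa [Polynomial.eval₂_at_apply, map_eq_zero_iff _ (IsFractionRing.injective V L)] at hx
  have hsurj (α : ResidueField V) (hα : α ∈ ι.fieldRange) : ∃ c ∈ C, ρ c = α :=
    IsUnramifiedOver.exists_mem_of_maximal hu (exists_eval_eq_zero_and_map_eq ρ hroot)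
      (by rintro _ ⟨a, rfl⟩; exact hι a) hC hα
  let i : k ≃+* ι.fieldRange := RingEquiv.ofBijective ι.rangeRestrictField
    ⟨ι.rangeRestrictField.injective, by rintro ⟨_, a, rfl⟩; exact ⟨a, rfl⟩⟩
  let σ : C →+* ι.fieldRange :=
    (ρ.comp C.subtype).codRestrict ι.fieldRange fun c ↦ hC.prop.2 c c.2
  let r : C →+* k := i.symm.toRingHom.comp σ
  have hr0 (c : C) : r c = 0 ↔ ρ c = 0 := by
    refine (map_eq_zero_iff _ i.symm.injective).trans ?_
    exact Subtype.ext_iff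
  obtain ⟨N, hN, s, hD, hs, hdvd, hp⟩ := exists_discreteValuationRing_of_dvd p r
    (fun a ↦ by
      obtain ⟨c, hc, h⟩ := hsurj (ι a) ⟨a, rfl⟩
      refine ⟨⟨c, hc⟩, ?_⟩
      refine (RingEquiv.symm_apply_eq i).mpr ?_
      exact Subtype.ext h)
    (fun c hc ↦ by
      rw [Ne, hr0] at hc
      obtain ⟨u, hu'⟩ := hu c hc
      have hmem : ((u⁻¹ : Vˣ) : V) ∈ C :=
        IsUnramifiedOver.mem_of_mul_mem_of_maximal hu hC c.2 hc (by simp [← hu'])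
      exact IsUnit.of_mul_eq_one ⟨_, hmem⟩ (Subtype.ext (by simp [← hu'])))
    (fun c hc ↦ by
      obtain ⟨d, hd, h⟩ := hC.prop.1 c c.2 ((hr0 c).mp hc)
      exact ⟨⟨d, hd⟩, Subtype.ext (by simp [h])⟩)
    (CharP.cast_eq_zero k p)
    (fun h ↦ by
      have h := congrArg (fun c : C ↦ ((c : V) : L)) h
      have h : ((p : ℕ) : L) = 0 := by simpa using h
      exact (Fact.out : p.Prime).ne_zero (by exact_mod_cast h))
  exact ⟨C ⧸ N, inferInstance, inferInstance, hD, s, hs, hdvd, hp⟩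

end CohenRing

theorem exists_coefficient_ring (T : Type) [CommRing T] [IsLocalRing T]
    [IsAdicComplete (maximalIdeal T) T] :
    ∃ (D : Type) (_ : CommRing D) (_ : IsLocalRing D) (_ : IsNoetherianRing D) (d : ℕ)
      (φ : D →+* T), HasRegularSequence D d D ∧ ringKrullDim D ≤ d ∧
        ∀ t : T, ∃ x, t - φ x ∈ maximalIdeal T := by
  obtain ⟨p, hchar⟩ := CharP.exists (ResidueField T)
  rcases CharP.char_is_prime_or_zero (ResidueField T) p with hp | rfl
  · have : Fact p.Prime := ⟨hp⟩
    obtain ⟨D, _, _, _, s, hs, hdvd, hp0⟩ :=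
      exists_discreteValuationRing_residueField (ResidueField T) p
    obtain ⟨φ, hφ⟩ := exists_ringHom_residue_comp_eq p s hs hdvd fun x hx ↦
      (mul_eq_zero.mp hx).resolve_left hp0
    refine ⟨D, inferInstance, inferInstance, inferInstance, 1, φ, ⟨p, ?_, ?_, trivial⟩, ?_,
      fun t ↦ ?_⟩
    · refine (mem_maximalIdeal _).mpr fun h ↦ (h.map s).ne_zero ?_
      rw [map_natCast, CharP.cast_eq_zero]
    · exact IsSMulRegular.of_ne_zero hp0
    · have : Ring.KrullDimLE 1 D := inferInstance
      exact Ring.krullDimLE_iff.mp this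
    · obtain ⟨x, hx⟩ := hs (residue T t)
      refine ⟨x, Ideal.Quotient.eq.mp ?_⟩
      exact (hx.symm.trans (DFunLike.congr_fun hφ x).symm :)
  · have : CharZero (ResidueField T) := CharP.charP_to_charZero _
    obtain ⟨φ, hφ⟩ := exists_coefficient_field_of_charZero T
    exact ⟨ResidueField T, inferInstance, inferInstance, inferInstance, 0, φ, trivial,
      by simp, fun t ↦ ⟨residue T t, Ideal.Quotient.eq.mp (hφ (residue T t)).symm⟩⟩

section PowerSeriesSurjection

open MvPolynomial in
theorem exists_mem_pow_idealOfVars_sub_mem {σ D T : Type} [CommRing D] [CommRing T] {φ : D →+* T}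
    {x : σ → T} {I : Ideal T} (hφ : ∀ t : T, ∃ d, t - φ d ∈ I)
    (hx : (idealOfVars σ D).map (eval₂Hom φ x) = I) {n : ℕ} {t : T} (ht : t ∈ I ^ n) :
    ∃ q ∈ idealOfVars σ D ^ n, t - eval₂Hom φ x q ∈ I ^ (n + 1) := by
  have hmem {q : MvPolynomial σ D} (hq : q ∈ idealOfVars σ D ^ n) :
      eval₂Hom φ x q ∈ I ^ n := by
    rw [← hx, ← Ideal.map_pow]
    exact Ideal.mem_map_of_mem _ hq
  rw [← hx, ← Ideal.map_pow] at ht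
  induction ht using Submodule.span_induction with
  | mem t ht =>
    obtain ⟨q, hq, rfl⟩ := ht
    exact ⟨q, hq, by simp⟩
  | zero => exact ⟨0, zero_mem _, by simp⟩
  | add t u _ _ ht hu =>
    obtain ⟨q, hq, ht⟩ := ht
    obtain ⟨r, hr, hu⟩ := hu
    refine ⟨q + r, add_mem hq hr, ?_⟩
    rw [map_add, add_sub_add_comm]
    exact add_mem ht hu
  | smul a t _ ht =>
    obtain ⟨q, hq, ht⟩ := ht
    obtain ⟨d, hd⟩ := hφ a
    refine ⟨C d * q, Ideal.mul_mem_left _ _ hq, ?_⟩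
    have : a • t - eval₂Hom φ x (C d * q) =
        a * (t - eval₂Hom φ x q) + (a - φ d) * eval₂Hom φ x q := by
      rw [map_mul, coe_eval₂Hom, eval₂_C, smul_eq_mul]
      ring
    rw [this]
    refine add_mem (Ideal.mul_mem_left _ _ ht) ?_
    rw [pow_succ']
    exact Ideal.mul_mem_mul hd (hmem hq)

open MvPolynomial in
/-- A complete ring is a quotient of a power series ring over any ring mapping onto its
residue ring. -/
theorem exists_surjective_of_mvPowerSeries {σ D T : Type} [Finite σ] [CommRing D] [CommRing T]
    {φ : D →+* T} {x : σ → T} {I : Ideal T} [IsAdicComplete I T]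
    (hφ : ∀ t : T, ∃ d, t - φ d ∈ I) (hx : Ideal.span (Set.range x) = I) :
    ∃ f : MvPowerSeries σ D →+* T, Function.Surjective f := by
  let g := eval₂Hom φ x
  have hg : (idealOfVars σ D).map g = I := by
    rw [Ideal.map_span, ← hx, ← Set.range_comp]
    congr 2
    ext i
    simp [g]
  have hle (n : ℕ) : idealOfVars σ D ^ n ≤ (I ^ n).comap g := by
    rw [← Ideal.map_le_iff_le_comap, Ideal.map_pow, hg]
  let F (n : ℕ) : MvPowerSeries σ D →+* T ⧸ I ^ n :=
    (Ideal.quotientMap (I ^ n) g (hle n)).comp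
      (MvPowerSeries.truncTotalAlgHom σ D n : MvPowerSeries σ D →+* _)
  have hF (n : ℕ) (p : MvPowerSeries σ D) :
      F n p = Ideal.Quotient.mk (I ^ n) (g (MvPowerSeries.truncTotal n p)) := rfl
  have hcomp {m n : ℕ} (h : m ≤ n) : (Ideal.Quotient.factorPow I h).comp (F n) = F m := by
    ext p
    rw [RingHom.comp_apply, hF, hF]
    change Ideal.Quotient.mk (I ^ m) _ = _
    rw [Ideal.Quotient.mk_eq_mk_iff_sub_mem, ← map_sub]
    exact hle m (MvPowerSeries.truncTotal_sub_truncTotal_mem_pow_idealOfVars h le_rfl p)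
  refine ⟨IsAdicComplete.liftRingHom I F hcomp, fun t ↦ ?_⟩
  have step (n : ℕ) (q : MvPolynomial σ D) (h : t - g q ∈ I ^ n) :
      ∃ q' : MvPolynomial σ D, t - g q' ∈ I ^ (n + 1) ∧ q' - q ∈ idealOfVars σ D ^ n := by
    obtain ⟨r, hr, h⟩ := exists_mem_pow_idealOfVars_sub_mem hφ hg h
    exact ⟨q + r, by rwa [map_add, ← sub_sub], by simpa⟩
  choose! next hnext hsub using step
  let q (n : ℕ) : MvPolynomial σ D := Nat.rec 0 (fun n q ↦ next n q) n
  have hq (n : ℕ) : t - g (q n) ∈ I ^ n := by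
    induction n with
    | zero => simp
    | succ n ih => exact hnext n _ ih
  let c : AdicCompletion (idealOfVars σ D) (MvPolynomial σ D) :=
    AdicCompletion.mk _ _ (AdicCompletion.AdicCauchySequence.mk _ _ q fun n ↦ by
      rw [SModEq.comm, SModEq.sub_mem, smul_eq_mul, Ideal.mul_top]
      exact hsub n _ (hq n))
  refine ⟨MvPowerSeries.toAdicCompletionInv σ D c, ?_⟩
  refine congrFun (IsHausdorff.funext' I (f := fun _ : Unit ↦ _) (g := fun _ ↦ t) fun n _ ↦ ?_) ()
  rw [IsAdicComplete.mk_liftRingHom, hF, Ideal.Quotient.mk_eq_mk_iff_sub_mem,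
    ← sub_add_sub_cancel _ (g (q n)), ← map_sub]
  refine add_mem (hle n ?_) (by simpa using neg_mem (hq n))
  have := MvPowerSeries.mk_truncTotal_toAdicCompletionInv (n := n) (f := c)
  have h2 : c.val n = Ideal.Quotient.mk (idealOfVars σ D ^ n • ⊤) (q n) := rfl
  rwa [h2, Ideal.Quotient.mk_eq_mk_iff_sub_mem, smul_eq_mul, Ideal.mul_top] at this

end PowerSeriesSurjection

section Catenary

theorem coheight_eq_add_one_of_covBy_of_surjective {R S : Type} [CommRing R] [CommRing S]
    {f : R →+* S} (hf : Function.Surjective f)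
    (h : ∀ p q : PrimeSpectrum R, p ⋖ q → Order.coheight p = Order.coheight q + 1)
    {p q : PrimeSpectrum S} (hpq : p ⋖ q) : Order.coheight p = Order.coheight q + 1 := by
  have hmono : StrictMono (PrimeSpectrum.comap f) :=
    Monotone.strictMono_of_injective (fun _ _ hab ↦ Ideal.comap_mono hab)
      (PrimeSpectrum.comap_injective_of_surjective f hf)
  have hup : ∀ a : PrimeSpectrum S, ∀ b : PrimeSpectrum R, PrimeSpectrum.comap f a < b →
      ∃ a', a < a' ∧ PrimeSpectrum.comap f a' = b := by
    intro a b hab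
    have hker : RingHom.ker f ≤ b.asIdeal :=
      (Ideal.ker_le_comap (K := a.asIdeal) f).trans hab.le
    have hb : PrimeSpectrum.comap f ⟨b.asIdeal.map f, Ideal.map_isPrime_of_surjective hf hker⟩ = b :=
      PrimeSpectrum.ext (by
        rw [PrimeSpectrum.comap_asIdeal, Ideal.comap_map_of_surjective f hf]
        exact sup_eq_left.2 hker)
    refine ⟨_, lt_of_le_of_ne ?_ ?_, hb⟩
    · have h1 : a.asIdeal ≤ (b.asIdeal).map f := by
        rw [← Ideal.map_comap_of_surjective f hf a.asIdeal]
        exact Ideal.map_mono hab.le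
      exact h1
    · intro h1
      exact hab.ne (by rw [← hb, ← h1])
  rw [Order.coheight_eq_of_strictMono _ hmono hup p, Order.coheight_eq_of_strictMono _ hmono hup q]
  refine h _ _ ⟨hmono hpq.lt, fun r hpr hrq ↦ ?_⟩
  obtain ⟨a, ha, rfl⟩ := hup p r hpr
  refine hpq.2 ha (lt_of_le_of_ne ?_ fun h1 ↦ hrq.ne (by rw [h1]))
  have h2 : a.asIdeal ≤ q.asIdeal := by
    rw [← Ideal.map_comap_of_surjective f hf a.asIdeal,
      ← Ideal.map_comap_of_surjective f hf q.asIdeal]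
    exact Ideal.map_mono hrq.le
  exact h2

theorem ringKrullDim_quotient_eq_coheight {R : Type} [CommRing R] (p : PrimeSpectrum R) :
    ringKrullDim (R ⧸ p.asIdeal) = Order.coheight p := by
  rw [ringKrullDim_quotient, Order.coheight_eq_krullDim_Ici]
  rfl

end Catenary

section GoingDown

variable {A T : Type} [CommRing A] [CommRing T] [Algebra A T]

theorem exists_covBy_of_covBy [IsNoetherianRing T] [Algebra.HasGoingDown A T]
    {p q : PrimeSpectrum A} (hpq : p ⋖ q) {Q : PrimeSpectrum T}
    (hQ : Q.asIdeal ∈ (q.asIdeal.map (algebraMap A T)).minimalPrimes)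
    (hcomap : PrimeSpectrum.comap (algebraMap A T) Q = q) :
    ∃ P : PrimeSpectrum T, P ⋖ Q ∧ P.asIdeal ∈ (p.asIdeal.map (algebraMap A T)).minimalPrimes ∧
      PrimeSpectrum.comap (algebraMap A T) P = p := by
  have : Q.asIdeal.LiesOver q.asIdeal := ⟨congrArg PrimeSpectrum.asIdeal hcomap.symm⟩
  obtain ⟨P', hP'Q, _, hover⟩ := Ideal.exists_ideal_lt_liesOver_of_lt (p := p.asIdeal)
    Q.asIdeal hpq.lt
  have hle : p.asIdeal.map (algebraMap A T) ≤ P' := by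
    rw [Ideal.map_le_iff_le_comap, hover.over]
  obtain ⟨P, hP, hPP'⟩ := Ideal.exists_minimalPrimes_le hle
  let P₀ : PrimeSpectrum T := ⟨P, hP.1.1⟩
  have hcP : PrimeSpectrum.comap (algebraMap A T) P₀ = p := by
    apply le_antisymm
    · change P.comap (algebraMap A T) ≤ p.asIdeal
      rw [hover.over]
      exact Ideal.comap_mono hPP'
    · exact Ideal.map_le_iff_le_comap.1 hP.1.2
  have hPQ : P₀ < Q := lt_of_le_of_lt (b := (⟨P', inferInstance⟩ : PrimeSpectrum T)) hPP' hP'Q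
  refine ⟨P₀, ⟨hPQ, fun R hPR hRQ ↦ ?_⟩, hP, hcP⟩
  obtain ⟨x, hxq, hxp⟩ := SetLike.exists_of_lt (show p.asIdeal < q.asIdeal from hpq.lt)
  obtain ⟨R', hxR', hPR', hR'Q⟩ := PrimeSpectrum.exist_mem_one_of_mem_two hPR hRQ
    (hQ.1.2 (Ideal.mem_map_of_mem (algebraMap A T) hxq))
  have hR'q : PrimeSpectrum.comap (algebraMap A T) R' = q := by
    have h1 : p ≤ PrimeSpectrum.comap (algebraMap A T) R' := by
      rw [← hcP]
      exact Ideal.comap_mono hPR'.le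
    have h2 : PrimeSpectrum.comap (algebraMap A T) R' ≤ q := by
      rw [← hcomap]
      exact Ideal.comap_mono hR'Q.le
    by_contra hne
    refine hpq.2 (lt_of_le_of_ne h1 fun h3 ↦ hxp ?_) (lt_of_le_of_ne h2 hne)
    rw [h3]
    exact hxR'
  refine not_le_of_gt hR'Q (hQ.2 ⟨R'.2, Ideal.map_le_iff_le_comap.2 ?_⟩ hR'Q.le)
  rw [← hR'q]
  rfl

/-- A saturated chain of primes of `A` below the contraction of the closed point lifts to a
saturated chain of primes of `T`. -/
theorem exists_minimalPrimes_coheight_eq [IsLocalRing T] [IsNoetherianRing T]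
    [Algebra.HasGoingDown A T]
    (hcat : ∀ P Q : PrimeSpectrum T, P ⋖ Q → Order.coheight P = Order.coheight Q + 1)
    {n : ℕ} {f : Fin (n + 1) → PrimeSpectrum A} (hsat : IsSaturatedChain f)
    (hmap : (f (Fin.last n)).asIdeal.map (algebraMap A T) = maximalIdeal T)
    (hcomap : PrimeSpectrum.comap (algebraMap A T) (closedPoint T) = f (Fin.last n)) :
    ∃ P : PrimeSpectrum T,
      P.asIdeal ∈ ((f 0).asIdeal.map (algebraMap A T)).minimalPrimes ∧ Order.coheight P = n := by
  have key (i : Fin (n + 1)) : ∃ P : PrimeSpectrum T,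
      P.asIdeal ∈ ((f i).asIdeal.map (algebraMap A T)).minimalPrimes ∧
      PrimeSpectrum.comap (algebraMap A T) P = f i ∧ Order.coheight P = (n - i : ℕ) := by
    induction i using Fin.reverseInduction with
    | last =>
      refine ⟨closedPoint T, ?_, hcomap, ?_⟩
      · rw [hmap]
        exact ⟨⟨inferInstance, le_rfl⟩, fun _ h _ ↦ h.2⟩
      · simp only [Fin.val_last, Nat.sub_self, Nat.cast_zero, Order.coheight_eq_zero]
        exact fun P _ ↦ IsLocalRing.le_maximalIdeal P.2.ne_top
    | cast i ih =>
      obtain ⟨Q, hQ, hQc, hQh⟩ := ih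
      obtain ⟨P, hPQ, hP, hPc⟩ := exists_covBy_of_covBy (hsat i) hQ hQc
      refine ⟨P, hP, hPc, ?_⟩
      rw [hcat P Q hPQ, hQh]
      norm_cast
      simp only [Fin.val_succ, Fin.val_castSucc]
      lia
  obtain ⟨P, hP, -, hh⟩ := key 0
  exact ⟨P, hP, by simpa using hh⟩

end GoingDown

section CompleteLocal

/-- Complete Noetherian local rings are catenary. -/
theorem coheight_eq_add_one_of_covBy_of_isAdicComplete (T : Type) [CommRing T] [IsLocalRing T]
    [IsNoetherianRing T] [IsAdicComplete (maximalIdeal T) T] {p q : PrimeSpectrum T}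
    (hpq : p ⋖ q) : Order.coheight p = Order.coheight q + 1 := by
  obtain ⟨D, _, _, _, d, φ, hreg, hdim, hφ⟩ := exists_coefficient_ring T
  obtain ⟨m, x, hx⟩ :=
    Submodule.fg_iff_exists_fin_generating_family.1 (maximalIdeal T).fg_of_isNoetherianRing
  obtain ⟨f, hf⟩ := exists_surjective_of_mvPowerSeries hφ hx
  obtain ⟨h1, h2⟩ := hasRegularSequence_mvPowerSeries hreg hdim m
  exact coheight_eq_add_one_of_covBy_of_surjective hf
    (fun _ _ ↦ coheight_eq_add_one_of_covBy_of_isCohenMacaulay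
      (isCohenMacaulayOfDim_of_hasRegularSequence h1 h2)) hpq

end CompleteLocal

/-- Let `(T,M)` be a complete Noetherian local ring and `A` a Noetherian local domain
whose completion is (isomorphic to) `T`.  If `A` contains a saturated chain of primes of
length `n` from `(0)` to its maximal ideal, then there is a minimal prime `P` of `T` with
`dim (T/P) = n`. -/
theorem stmt4 (A T : Type) [CommRing A] [IsDomain A] [IsLocalRing A] [IsNoetherianRing A]
    [CommRing T] [IsLocalRing T] [IsNoetherianRing T]
    [IsAdicComplete (maximalIdeal T) T] [Algebra A T]
    (hcompl : ∃ e : AdicCompletion (maximalIdeal A) A ≃+* T,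
      ∀ a : A, e (algebraMap A (AdicCompletion (maximalIdeal A) A) a) = algebraMap A T a)
    (n : ℕ) (f : Fin (n + 1) → PrimeSpectrum A)
    (hsat : IsSaturatedChain f)
    (h0 : f 0 = ⟨⊥, Ideal.bot_prime⟩)
    (hlast : (f (Fin.last n)).asIdeal = maximalIdeal A) :
    ∃ P ∈ minimalPrimes T, ringKrullDim (T ⧸ P) = (n : WithBot ℕ∞) := by
  obtain ⟨e, he⟩ := hcompl
  let e' : AdicCompletion (maximalIdeal A) A ≃ₐ[A] T := AlgEquiv.ofRingEquiv he
  have : Module.Flat A T := Module.Flat.of_linearEquiv e'.toLinearEquiv.symm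
  have hmap : (maximalIdeal A).map (algebraMap A T) = maximalIdeal T := by
    rw [← e'.toAlgHom.comp_algebraMap, ← Ideal.map_map, ← AdicCompletion.maximalIdeal_eq_map]
    exact IsLocalRing.map_ringEquiv_maximalIdeal e
  have hcomap : PrimeSpectrum.comap (algebraMap A T) (closedPoint T) = f (Fin.last n) := by
    apply PrimeSpectrum.ext
    rw [hlast]
    refine ((maximalIdeal.isMaximal A).eq_of_le (PrimeSpectrum.comap _ _).2.ne_top ?_).symm
    exact Ideal.map_le_iff_le_comap.1 hmap.le
  obtain ⟨P, hP, hh⟩ := exists_minimalPrimes_coheight_eq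
    (fun _ _ ↦ coheight_eq_add_one_of_covBy_of_isAdicComplete T) hsat (by rwa [hlast]) hcomap
  refine ⟨P.asIdeal, ?_, ?_⟩
  · rw [h0] at hP
    simpa [minimalPrimes] using hP
  · rw [ringKrullDim_quotient_eq_coheight, hh]
    rfl
end
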